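/- If M and N are indecomposable preprojective k(Γ,Λ)-modules, then [M] ⪯ [N] in the path order on isomorphism classes of indecomposable preprojective modules if and only if S_M ⪯ S_N in 𝔖. -/

import Mathlib

namespace KP

/-! ## Quivers on a fixed vertex set `Fin n`.

An orientation is encoded by `Λ : Fin n → Fin n → ℕ`, where `Λ a b` is the number of
arrows from `a` to `b`.  The underlying graph is recorded by `edges Λ a b = Λ a b + Λ b a`. -/

/-- The orientation `σ_x Λ` obtained by reversing every arrow incident with `x`. -/
def flipO {n : ℕ} (x : Fin n) (Λ : Fin n → Fin n → ℕ) : Fin n → Fin n → ℕ :=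
  fun a b => if a = x ∨ b = x then Λ b a else Λ a b

/-- Number of edges of the underlying graph joining `a` and `b`. -/
def edges {n : ℕ} (Λ : Fin n → Fin n → ℕ) (a b : Fin n) : ℕ := Λ a b + Λ b a

/-- `x` is a sink: no arrow starts at `x`. -/
def IsSink {n : ℕ} (Λ : Fin n → Fin n → ℕ) (x : Fin n) : Prop := ∀ y, Λ x y = 0

/-- `S` is a `(+)`-admissible sequence of vertices on `(Γ, Λ)`. -/
def Admissible {n : ℕ} (Λ : Fin n → Fin n → ℕ) : List (Fin n) → Prop
  | [] => True
  | x :: xs => IsSink Λ x ∧ Admissible (flipO x Λ) xs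

/-- The orientation `Λ^S`. -/
def orientAfter {n : ℕ} (Λ : Fin n → Fin n → ℕ) : List (Fin n) → (Fin n → Fin n → ℕ)
  | [] => Λ
  | x :: xs => orientAfter (flipO x Λ) xs

/-- Elementary move: interchange two consecutive vertices not joined by an edge. -/
inductive SwapRel {n : ℕ} (E : Fin n → Fin n → ℕ) : List (Fin n) → List (Fin n) → Prop
  | swap (l₁ l₂ : List (Fin n)) (a b : Fin n) (h : E a b = 0) :
      SwapRel E (l₁ ++ a :: b :: l₂) (l₁ ++ b :: a :: l₂)

/-- The equivalence `∼` on sequences of vertices: reflexive–transitive closure of the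
(symmetric) relation `SwapRel`. -/
def Sim {n : ℕ} (E : Fin n → Fin n → ℕ) : List (Fin n) → List (Fin n) → Prop :=
  Relation.ReflTransGen (SwapRel E)

/-- The preorder `S ⪯ T` : `T ∼ S ++ U` for some `(+)`-admissible sequence `U` on `(Γ, Λ^S)`. -/
def Preceq {n : ℕ} (Λ : Fin n → Fin n → ℕ) (S T : List (Fin n)) : Prop :=
  ∃ U, Admissible (orientAfter Λ S) U ∧ Sim (edges Λ) T (S ++ U)

/-- Support of a sequence of vertices. -/
def suppOf {n : ℕ} (S : List (Fin n)) : Set (Fin n) := {v | v ∈ S}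

/-- The partial order on vertices: `x ≤ y` iff there is a path from `x` to `y` in `(Γ, Λ)`. -/
def PathLE {n : ℕ} (Λ : Fin n → Fin n → ℕ) (x y : Fin n) : Prop :=
  Relation.ReflTransGen (fun a b => Λ a b ≠ 0) x y

/-- A filter (up-closed set) of the poset `(Γ₀, Λ)`. -/
def IsFilter {n : ℕ} (Λ : Fin n → Fin n → ℕ) (F : Set (Fin n)) : Prop :=
  ∀ x ∈ F, ∀ y, PathLE Λ x y → y ∈ F

/-- The principal filter `⟨x⟩`. -/
def upSet {n : ℕ} (Λ : Fin n → Fin n → ℕ) (x : Fin n) : Set (Fin n) := {y | PathLE Λ x y}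

/-- The hull `H_Λ(F)`: the smallest filter containing `F` and every vertex joined
by an edge to a vertex of `F`. -/
def hull {n : ℕ} (Λ : Fin n → Fin n → ℕ) (F : Set (Fin n)) : Set (Fin n) :=
  {y | ∃ x, (x ∈ F ∨ ∃ z ∈ F, edges Λ z x ≠ 0) ∧ PathLE Λ x y}

/-- `segs` is a canonical form of `S` (Proposition 2.1): `S ∼ S₁S₂⋯S_r`, each segment
consists of distinct vertices, is nonempty, and `Supp S_i = Supp (S_i S_{i+1} ⋯ S_r)`. -/
def Segments {n : ℕ} (Λ : Fin n → Fin n → ℕ) (S : List (Fin n))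
    (segs : List (List (Fin n))) : Prop :=
  Admissible Λ segs.flatten ∧ Sim (edges Λ) S segs.flatten ∧
  (∀ seg ∈ segs, seg ≠ [] ∧ seg.Nodup) ∧
  ∀ i, i < segs.length → suppOf (segs.getD i []) = suppOf ((segs.drop i).flatten)

/-- `J` is (a representative of) the join `S ∨ T` (Definition 2.4):  the canonical form of `J`
has `Supp R_i = Supp S_i ∪ Supp T_i` (out-of-range segments read as `∅`). -/
def IsJoin {n : ℕ} (Λ : Fin n → Fin n → ℕ) (S T J : List (Fin n)) : Prop :=
  ∃ CS CT CJ, Segments Λ S CS ∧ Segments Λ T CT ∧ Segments Λ J CJ ∧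
    ∀ i, suppOf (CJ.getD i []) = suppOf (CS.getD i []) ∪ suppOf (CT.getD i [])

/-- `M` is (a representative of) the meet `S ∧ T` (Definition 2.4). -/
def IsMeet {n : ℕ} (Λ : Fin n → Fin n → ℕ) (S T M : List (Fin n)) : Prop :=
  ∃ CS CT CM, Segments Λ S CS ∧ Segments Λ T CT ∧ Segments Λ M CM ∧
    ∀ i, suppOf (CM.getD i []) = suppOf (CS.getD i []) ∩ suppOf (CT.getD i [])

/-- `S` is (equivalent to) the join `T₁ ∨ ⋯ ∨ T_l` of the list of sequences `Ts`. -/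
def IsJoinList {n : ℕ} (Λ : Fin n → Fin n → ℕ) : List (List (Fin n)) → List (Fin n) → Prop
  | [], S => S = []
  | T :: Ts, S => ∃ J, IsJoinList Λ Ts J ∧ IsJoin Λ T J S

/-- The segments of a canonical form of a principal sequence `S_{r,x}` (Definition 3.1). -/
def PrincipalSegs {n : ℕ} (Λ : Fin n → Fin n → ℕ) (segs : List (List (Fin n)))
    (r : ℕ) (x : Fin n) : Prop :=
  segs.length = r ∧ 0 < r ∧
  (∀ i, i + 1 < r → suppOf (segs.getD i []) = hull Λ (suppOf (segs.getD (i+1) []))) ∧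
  suppOf (segs.getD (r-1) []) = upSet Λ x

/-- `S ∼ S_{r,x}`, the principal `(+)`-admissible sequence of size `r` with
`Supp S_r = ⟨x⟩`. -/
def IsPrincipalSeq {n : ℕ} (Λ : Fin n → Fin n → ℕ) (r : ℕ) (x : Fin n)
    (S : List (Fin n)) : Prop :=
  ∃ segs, Segments Λ S segs ∧ PrincipalSegs Λ segs r x

/-- `S` is a principal `(+)`-admissible sequence. -/
def IsPrincipal {n : ℕ} (Λ : Fin n → Fin n → ℕ) (S : List (Fin n)) : Prop :=
  ∃ r x, IsPrincipalSeq Λ r x S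


/-! ## Representations of `(Γ, Λ)` over a field `k`. -/

/-- A (finite-dimensional) representation of the quiver `(Γ, Λ)` over `k`:
the space at vertex `x` is `Fin (d x) → k`, and each arrow carries a linear map. -/
structure Rep (k : Type) [Field k] (n : ℕ) (Λ : Fin n → Fin n → ℕ) where
  d : Fin n → ℕ
  f : ∀ a b : Fin n, Fin (Λ a b) → ((Fin (d a) → k) →ₗ[k] (Fin (d b) → k))

variable {k : Type} [Field k] {n : ℕ}

/-- A morphism of representations. -/
structure RepHom {Λ : Fin n → Fin n → ℕ} (M N : Rep k n Λ) where
  g : ∀ x, (Fin (M.d x) → k) →ₗ[k] (Fin (N.d x) → k)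
  comm : ∀ a b i v, g b (M.f a b i v) = N.f a b i (g a v)

/-- Isomorphism of representations. -/
def RepIso {Λ : Fin n → Fin n → ℕ} (M N : Rep k n Λ) : Prop :=
  ∃ g : ∀ x, (Fin (M.d x) → k) ≃ₗ[k] (Fin (N.d x) → k),
    ∀ a b i v, g b (M.f a b i v) = N.f a b i (g a v)

/-- The zero representation. -/
def IsZeroRep {Λ : Fin n → Fin n → ℕ} (M : Rep k n Λ) : Prop := ∀ x, M.d x = 0

/-- Cast between the standard spaces. -/
def castL (k : Type) [Field k] {m m' : ℕ} (h : m = m') : (Fin m → k) ≃ₗ[k] (Fin m' → k) :=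
  LinearEquiv.funCongrLeft k k (finCongr h.symm)

/-- The splitting `(Fin (m + p) → k) ≃ₗ (Fin m → k) × (Fin p → k)`. -/
def splitL (k : Type) [Field k] (m p : ℕ) : (Fin (m + p) → k) ≃ₗ[k] (Fin m → k) × (Fin p → k) :=
  (LinearEquiv.funCongrLeft k k finSumFinEquiv).trans
    (LinearEquiv.sumArrowLequivProdArrow _ _ k k)

/-- Direct sum of two representations. -/
def dSum {Λ : Fin n → Fin n → ℕ} (M N : Rep k n Λ) : Rep k n Λ where
  d x := M.d x + N.d x
  f a b i :=
    (splitL k (M.d b) (N.d b)).symm.toLinearMap ∘ₗ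
      (LinearMap.prodMap (M.f a b i) (N.f a b i)) ∘ₗ (splitL k (M.d a) (N.d a)).toLinearMap

/-- The zero representation (as an object). -/
def zeroRep (k : Type) [Field k] (n : ℕ) (Λ : Fin n → Fin n → ℕ) : Rep k n Λ where
  d _ := 0
  f _ _ _ := 0

/-- Direct sum of a list of representations. -/
def dSumList {Λ : Fin n → Fin n → ℕ} (L : List (Rep k n Λ)) : Rep k n Λ :=
  L.foldr dSum (zeroRep k n Λ)

/-- `M` is indecomposable. -/
def Indecomp {Λ : Fin n → Fin n → ℕ} (M : Rep k n Λ) : Prop :=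
  ¬ IsZeroRep M ∧ ∀ A B : Rep k n Λ, RepIso M (dSum A B) → IsZeroRep A ∨ IsZeroRep B

/-- `X` is a direct summand of `M`. -/
def IsSummand {Λ : Fin n → Fin n → ℕ} (X M : Rep k n Λ) : Prop :=
  ∃ Y, RepIso M (dSum X Y)

/-! ### Reflection functors (on objects) -/

/-- Index type of the arrows ending at `x`. -/
abbrev Arin {n : ℕ} (Λ : Fin n → Fin n → ℕ) (x : Fin n) := Σ y : Fin n, Fin (Λ y x)

/-- Index type of the arrows starting at `x`. -/
abbrev Aout {n : ℕ} (Λ : Fin n → Fin n → ℕ) (x : Fin n) := Σ y : Fin n, Fin (Λ x y)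

/-- The map `h : ⊕_{a : y → x} V(y) → V(x)` induced by the maps along the arrows ending at `x`. -/
noncomputable def inMap (Λ : Fin n → Fin n → ℕ) (M : Rep k n Λ) (x : Fin n) :
    ((p : Arin Λ x) → (Fin (M.d p.1) → k)) →ₗ[k] (Fin (M.d x) → k) :=
  ∑ p : Arin Λ x, (M.f p.1 x p.2) ∘ₗ LinearMap.proj p

/-- The map `h' : V(x) → ⊕_{a : x → y} V(y)` induced by the maps along arrows starting at `x`. -/
def outMap (Λ : Fin n → Fin n → ℕ) (M : Rep k n Λ) (x : Fin n) :
    (Fin (M.d x) → k) →ₗ[k] ((p : Aout Λ x) → (Fin (M.d p.1) → k)) :=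
  LinearMap.pi fun p => M.f x p.1 p.2

noncomputable def kerEquiv (Λ : Fin n → Fin n → ℕ) (M : Rep k n Λ) (x : Fin n) :
    LinearMap.ker (inMap Λ M x) ≃ₗ[k]
      (Fin (Module.finrank k (LinearMap.ker (inMap Λ M x))) → k) :=
  (Module.finBasis k _).equivFun

noncomputable def cokerEquiv (Λ : Fin n → Fin n → ℕ) (M : Rep k n Λ) (x : Fin n) :
    (((p : Aout Λ x) → (Fin (M.d p.1) → k)) ⧸ LinearMap.range (outMap Λ M x)) ≃ₗ[k]
      (Fin (Module.finrank k (((p : Aout Λ x) → (Fin (M.d p.1) → k)) ⧸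
        LinearMap.range (outMap Λ M x))) → k) :=
  (Module.finBasis k _).equivFun

/-- The positive reflection functor `F_x⁺` (on objects): the space at `x` is replaced
by the kernel of `inMap`, with the maps along the reversed arrows induced by inclusion
followed by the projections. -/
noncomputable def reflPlus (x : Fin n) (Λ : Fin n → Fin n → ℕ) (M : Rep k n Λ) :
    Rep k n (flipO x Λ) where
  d z := if z = x then Module.finrank k (LinearMap.ker (inMap Λ M x)) else M.d z
  f a b i :=
    if ha : a = x then
      if hb : b = x then 0
      else
        (castL k (if_neg hb).symm).toLinearMap ∘ₗ
          (LinearMap.proj (φ := fun p : Arin Λ x => Fin (M.d p.1) → k)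
            (⟨b, Fin.cast (by subst ha; simp [flipO]) i⟩ : Arin Λ x)) ∘ₗ
          (LinearMap.ker (inMap Λ M x)).subtype ∘ₗ
          (kerEquiv Λ M x).symm.toLinearMap ∘ₗ (castL k (if_pos ha)).toLinearMap
    else
      if hb : b = x then 0
      else
        (castL k (if_neg hb).symm).toLinearMap ∘ₗ
          M.f a b (Fin.cast (by simp [flipO, ha, hb]) i) ∘ₗ
          (castL k (if_neg ha)).toLinearMap

/-- The negative reflection functor `F_x⁻` (on objects), presented as a map from
representations of `(Γ, σ_x Λ)` to representations of `(Γ, Λ)`: the space at `x` is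
replaced by the cokernel of `outMap`. -/
noncomputable def reflMinus (x : Fin n) (Λ : Fin n → Fin n → ℕ)
    (N : Rep k n (flipO x Λ)) : Rep k n Λ where
  d z := if z = x then
      Module.finrank k (((p : Aout (flipO x Λ) x) → (Fin (N.d p.1) → k)) ⧸
        LinearMap.range (outMap (flipO x Λ) N x))
    else N.d z
  f a b i :=
    if hb : b = x then
      if ha : a = x then 0
      else
        (castL k (if_pos hb).symm).toLinearMap ∘ₗ
          (cokerEquiv (flipO x Λ) N x).toLinearMap ∘ₗ
          (LinearMap.range (outMap (flipO x Λ) N x)).mkQ ∘ₗ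
          (LinearMap.single k (fun p : Aout (flipO x Λ) x => Fin (N.d p.1) → k)
            (⟨a, Fin.cast (by subst hb; simp [flipO]) i⟩ : Aout (flipO x Λ) x)) ∘ₗ
          (castL k (if_neg ha)).toLinearMap
    else
      if ha : a = x then 0
      else
        (castL k (if_neg hb).symm).toLinearMap ∘ₗ
          N.f a b (Fin.cast (by simp [flipO, ha, hb]) i) ∘ₗ
          (castL k (if_neg ha)).toLinearMap

/-- `F(S) = F_{x_s}⁺ ⋯ F_{x_1}⁺` applied to a representation. -/
noncomputable def FList : (S : List (Fin n)) → (Λ : Fin n → Fin n → ℕ) → Rep k n Λ →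
    Rep k n (orientAfter Λ S)
  | [], _, M => M
  | x :: xs, Λ, M => FList xs (flipO x Λ) (reflPlus x Λ M)

/-- `S` annihilates `M` : `F(S) M = 0`. -/
def Annihilates (Λ : Fin n → Fin n → ℕ) (S : List (Fin n)) (M : Rep k n Λ) : Prop :=
  IsZeroRep (FList S Λ M)

/-- `M` is preprojective: some `(+)`-admissible sequence annihilates it. -/
def Preprojective (Λ : Fin n → Fin n → ℕ) (M : Rep k n Λ) : Prop :=
  ∃ S, Admissible Λ S ∧ Annihilates Λ S M

/-- `S` is a shortest `(+)`-admissible sequence annihilating `M` : it annihilates `M` and no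
proper subsequence of `S` annihilates `M`.  (This predicate is invariant under `∼`, so it
expresses `S ∼ S_M`.) -/
def IsShortestAnn (Λ : Fin n → Fin n → ℕ) (M : Rep k n Λ) (S : List (Fin n)) : Prop :=
  Admissible Λ S ∧ Annihilates Λ S M ∧
  ∀ S', Admissible Λ S' → Annihilates Λ S' M → Preceq Λ S' S → Sim (edges Λ) S' S

/-- The simple representation `L_x` concentrated at the vertex `x`. -/
def simpleRep (Λ : Fin n → Fin n → ℕ) (x : Fin n) : Rep k n Λ where
  d z := if z = x then 1 else 0
  f _ _ _ := 0

/-- `M(S) = F_{x₁}⁻ F_{x₂}⁻ ⋯ F_{x_{s-1}}⁻ (L_{x_s})`, where `L_{x_s}` is the simple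
(projective) module over `k(Γ, σ_{x_{s-1}} ⋯ σ_{x_1} Λ)` at the vertex `x_s`. -/
noncomputable def Mof : (Λ : Fin n → Fin n → ℕ) → (S : List (Fin n)) → Rep k n Λ
  | Λ, [] => zeroRep k n Λ
  | Λ, [x] => simpleRep Λ x
  | Λ, x :: y :: ys => reflMinus x Λ (Mof (flipO x Λ) (y :: ys))

variable {n : ℕ}

/-! ## The Weyl group -/

/-- The simple reflection `σ_i` attached to a generalized Cartan matrix `A`,
as a linear endomorphism of `ℤⁿ` : `σ_i(v) = v - (∑ l, a_{il} v_l) e_i`. -/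
def sigmaL (A : Fin n → Fin n → ℤ) (i : Fin n) : (Fin n → ℤ) →ₗ[ℤ] (Fin n → ℤ) where
  toFun v := v - (∑ l, A i l * v l) • Pi.single i 1
  map_add' v w := by
    simp only [Pi.add_apply, mul_add, Finset.sum_add_distrib, add_smul]
    abel
  map_smul' c v := by
    simp only [Pi.smul_apply, smul_eq_mul, RingHom.id_apply, smul_sub]
    congr 1
    rw [smul_smul, Finset.mul_sum]
    congr 1
    exact Finset.sum_congr rfl fun l _ => by ring

theorem sigma_invol (A : Fin n → Fin n → ℤ) (hA : ∀ i, A i i = 2) (i : Fin n) :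
    (sigmaL A i).comp (sigmaL A i) = LinearMap.id := by
  apply LinearMap.ext
  intro v
  simp only [LinearMap.comp_apply, LinearMap.id_apply, sigmaL, LinearMap.coe_mk, AddHom.coe_mk]
  set c := ∑ l, A i l * v l with hc
  set s : Fin n → ℤ := Pi.single i 1 with hs
  have h1 : ∑ l, A i l * (v - c • s) l = -c := by
    have h2 : ∀ l, A i l * (v - c • s) l = A i l * v l - c * (A i l * s l) := fun l => by
      simp only [Pi.sub_apply, Pi.smul_apply, smul_eq_mul]
      ring
    rw [Finset.sum_congr rfl fun l _ => h2 l, Finset.sum_sub_distrib, ← Finset.mul_sum]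
    have h3 : ∑ l, A i l * s l = 2 := by
      rw [Finset.sum_eq_single i]
      · simp [hs, hA i]
      · intro b _ hb
        simp [hs, Pi.single_eq_of_ne hb]
      · simp
    rw [h3, ← hc]
    ring
  rw [h1]
  ext j
  simp only [Pi.sub_apply, Pi.smul_apply, smul_eq_mul]
  ring

/-- The simple reflection `σ_i` as an automorphism of `ℤⁿ`. -/
def sigmaE (A : Fin n → Fin n → ℤ) (hA : ∀ i, A i i = 2) (i : Fin n) :
    (Fin n → ℤ) ≃ₗ[ℤ] (Fin n → ℤ) :=
  LinearEquiv.ofLinear (sigmaL A i) (sigmaL A i) (sigma_invol A hA i) (sigma_invol A hA i)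

/-- The length `ℓ(w)`: the least `l ≥ 0` such that `w` is a product of `l` simple
reflections. -/
noncomputable def wordLen (A : Fin n → Fin n → ℤ) (hA : ∀ i, A i i = 2)
    (w : (Fin n → ℤ) ≃ₗ[ℤ] (Fin n → ℤ)) : ℕ :=
  sInf {l | ∃ ys : List (Fin n), ys.length = l ∧ w = (ys.map (sigmaE A hA)).prod}

/-- The word `w(S) = σ_{x_s} ⋯ σ_{x_1}` associated to a sequence `S = x₁, …, x_s`. -/
def wordOf (A : Fin n → Fin n → ℤ) (hA : ∀ i, A i i = 2) (S : List (Fin n)) :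
    (Fin n → ℤ) ≃ₗ[ℤ] (Fin n → ℤ) :=
  ((S.reverse).map (sigmaE A hA)).prod

/-- The symmetric generalized Cartan matrix of the underlying graph of `(Γ, Λ)`. -/
def cartanOf (Λ : Fin n → Fin n → ℕ) : Fin n → Fin n → ℤ :=
  fun i j => if i = j then 2 else -(edges Λ i j : ℤ)

theorem cartan_diag (Λ : Fin n → Fin n → ℕ) : ∀ i, cartanOf Λ i i = 2 := by
  intro i; simp [cartanOf]

/-- The simple reflections of the Weyl group of the underlying graph of `(Γ, Λ)`. -/
def wSig (Λ : Fin n → Fin n → ℕ) : Fin n → ((Fin n → ℤ) ≃ₗ[ℤ] (Fin n → ℤ)) :=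
  sigmaE (cartanOf Λ) (cartan_diag Λ)

/-- `w(S)` for a sequence of vertices of `(Γ, Λ)`. -/
def wordOfSeq (Λ : Fin n → Fin n → ℕ) (S : List (Fin n)) :
    (Fin n → ℤ) ≃ₗ[ℤ] (Fin n → ℤ) :=
  ((S.reverse).map (wSig Λ)).prod

/-- The word `w(S)` is reduced: `ℓ(w(S))` equals the number of letters of `S`. -/
noncomputable def IsReducedSeq (Λ : Fin n → Fin n → ℕ) (S : List (Fin n)) : Prop :=
  wordLen (cartanOf Λ) (cartan_diag Λ) (wordOfSeq Λ S) = S.length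

/-! ## Dynkin graphs of types A, D, E -/

def edgeA (n : ℕ) : Fin n → Fin n → ℕ := fun i j =>
  if (i : ℕ) + 1 = (j : ℕ) ∨ (j : ℕ) + 1 = (i : ℕ) then 1 else 0

def edgeD (n : ℕ) : Fin n → Fin n → ℕ := fun i j =>
  if ((i : ℕ) = 0 ∧ (j : ℕ) = 2) ∨ ((j : ℕ) = 0 ∧ (i : ℕ) = 2) ∨
     ((i : ℕ) = 1 ∧ (j : ℕ) = 2) ∨ ((j : ℕ) = 1 ∧ (i : ℕ) = 2) ∨
     (2 ≤ (i : ℕ) ∧ (i : ℕ) + 1 = (j : ℕ)) ∨ (2 ≤ (j : ℕ) ∧ (j : ℕ) + 1 = (i : ℕ))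
  then 1 else 0

def edgeE (n : ℕ) : Fin n → Fin n → ℕ := fun i j =>
  if ((i : ℕ) + 1 = (j : ℕ) ∧ (j : ℕ) ≤ n - 2) ∨ ((j : ℕ) + 1 = (i : ℕ) ∧ (i : ℕ) ≤ n - 2) ∨
     ((i : ℕ) = 2 ∧ (j : ℕ) = n - 1) ∨ ((j : ℕ) = 2 ∧ (i : ℕ) = n - 1)
  then 1 else 0

/-- The underlying graph (given by its edge-count function `E`) is a Dynkin diagram of
type `A`, `D`, or `E`. -/
def IsDynkinADE (n : ℕ) (E : Fin n → Fin n → ℕ) : Prop :=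
  ∃ e : Fin n ≃ Fin n,
    (∀ i j, E i j = edgeA n (e i) (e j)) ∨
    (4 ≤ n ∧ ∀ i j, E i j = edgeD n (e i) (e j)) ∨
    ((n = 6 ∨ n = 7 ∨ n = 8) ∧ ∀ i j, E i j = edgeE n (e i) (e j))

/-! ## Coxeter-sortable elements -/

/-- Lexicographic comparison of index tuples. -/
def lexLE {s : ℕ} (ι ι' : Fin s → ℕ) : Prop :=
  ι = ι' ∨ ∃ j, (∀ j', j' < j → ι j' = ι' j') ∧ ι j < ι' j

/-- `w` is `c`-sortable for the Coxeter element determined by the half-infinite word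
`cseq` (with dividers every `blockLen` letters): the lexicographically first subsequence
of `cseq` that is a reduced word for `w` defines a sequence of subsets (between adjacent
dividers) that is decreasing under inclusion. -/
def CSortable (A : Fin n → Fin n → ℤ) (hA : ∀ i, A i i = 2) (cseq : ℕ → Fin n)
    (blockLen : ℕ) (w : (Fin n → ℤ) ≃ₗ[ℤ] (Fin n → ℤ)) : Prop :=
  ∃ (s : ℕ) (ι : Fin s → ℕ), StrictMono ι ∧
    w = ((List.ofFn fun j => cseq (ι j)).map (sigmaE A hA)).prod ∧
    wordLen A hA w = s ∧
    (∀ ι' : Fin s → ℕ, StrictMono ι' →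
      w = ((List.ofFn fun j => cseq (ι' j)).map (sigmaE A hA)).prod → lexLE ι ι') ∧
    ∀ m : ℕ, {a : Fin n | ∃ j, (ι j) / blockLen = m + 1 ∧ cseq (ι j) = a} ⊆
             {a : Fin n | ∃ j, (ι j) / blockLen = m ∧ cseq (ι j) = a}


/-- A nonzero non-isomorphism between representations. -/
def RepStep {k : Type} [Field k] {n : ℕ} {Λ : Fin n → Fin n → ℕ} (X Y : Rep k n Λ) : Prop :=
  ∃ f : RepHom X Y, (∃ x v, f.g x v ≠ 0) ∧ ¬ ∀ x, Function.Bijective (f.g x)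

/-- `v` is a minimal element of `D` in the poset `(Γ₀, Λ)`. -/
def MinimalIn {n : ℕ} (Λ : Fin n → Fin n → ℕ) (D : Set (Fin n)) (v : Fin n) : Prop :=
  v ∈ D ∧ ∀ u ∈ D, PathLE Λ u v → u = v

/-- The pairs `(h, v)` of Proposition 3.2(a): `0 < h ≤ r` and `v` a minimal element of
`Supp S_h \ H_Λ(Supp S_{h+1})` (with `Supp S_{r+1} = ∅`). -/
def JoinPair {n : ℕ} (Λ : Fin n → Fin n → ℕ) (segs : List (List (Fin n)))
    (p : ℕ × Fin n) : Prop :=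
  0 < p.1 ∧ p.1 ≤ segs.length ∧
  MinimalIn Λ (suppOf (segs.getD (p.1 - 1) []) \ hull Λ (suppOf (segs.getD p.1 []))) p.2

section Comb
variable {m : ℕ}

/-- Simple reflection on integer vectors attached to an edge function. -/
def sg (E : Fin m → Fin m → ℕ) (x : Fin m) (d : Fin m → ℤ) : Fin m → ℤ :=
  fun z => if z = x then (∑ y, (E x y : ℤ) * d y) - d x else d z

/-- Numerical version of annihilation. -/
def AnnV (E : Fin m → Fin m → ℕ) : List (Fin m) → (Fin m → ℤ) → Prop
  | [], d => ¬ 0 ≤ d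
  | x :: S, d => ¬ 0 ≤ d ∨ AnnV E S (sg E x d)

theorem AnnV.of_neg {E : Fin m → Fin m → ℕ} (S : List (Fin m)) {d : Fin m → ℤ}
    (h : ¬ 0 ≤ d) : AnnV E S d := by
  cases S with
  | nil => exact h
  | cons x S => exact Or.inl h

theorem edges_symm (Λ : Fin m → Fin m → ℕ) (a b) : edges Λ a b = edges Λ b a := by
  simp [edges, add_comm]

theorem edges_flip (x : Fin m) (Λ : Fin m → Fin m → ℕ) : edges (flipO x Λ) = edges Λ := by
  funext a b
  simp only [edges, flipO]
  by_cases h : a = x ∨ b = x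
  · rw [if_pos h, if_pos h.symm, add_comm]
  · rw [if_neg h, if_neg (fun h' => h h'.symm)]

theorem flip_comm (x y : Fin m) (Λ : Fin m → Fin m → ℕ) :
    flipO x (flipO y Λ) = flipO y (flipO x Λ) := by
  funext a b
  simp only [flipO]
  by_cases h1 : a = x <;> by_cases h2 : b = x <;> by_cases h3 : a = y <;> by_cases h4 : b = y <;>
    simp [h1, h2, h3, h4]

theorem edges_after (S : List (Fin m)) : ∀ Λ : Fin m → Fin m → ℕ,
    edges (orientAfter Λ S) = edges Λ := by
  induction S with
  | nil => intro Λ; rfl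
  | cons x S ih => intro Λ; simp only [orientAfter]; rw [ih, edges_flip]

theorem sg_comm {E : Fin m → Fin m → ℕ} (hE : ∀ a b, E a b = E b a) {x y : Fin m}
    (h : E x y = 0) (d : Fin m → ℤ) : sg E x (sg E y d) = sg E y (sg E x d) := by
  by_cases hxy : x = y
  · subst hxy; rfl
  have h' : E y x = 0 := by rw [hE]; exact h
  have key : ∀ u v : Fin m, E u v = 0 → ∀ d : Fin m → ℤ,
      ∑ z, (E u z : ℤ) * sg E v d z = ∑ z, (E u z : ℤ) * d z := by
    intro u v huv d
    apply Finset.sum_congr rfl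
    intro z _
    by_cases hz : z = v
    · subst hz; simp [huv]
    · simp [sg, hz]
  funext z
  have e1 : ∀ u v : Fin m, E u v = 0 → u ≠ v → ∀ d, sg E u (sg E v d) u = sg E u d u := by
    intro u v huv hne d
    have : sg E v d u = d u := by simp [sg, hne]
    show (if u = u then _ else _) = (if u = u then _ else _)
    rw [if_pos rfl, if_pos rfl, key u v huv, this]
  by_cases hx : z = x
  · subst hx
    rw [e1 z y h hxy]
    simp [sg, hxy]
  · by_cases hy : z = y
    · subst hy
      rw [e1 z x h' (Ne.symm hxy)]
      simp [sg, hx]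
    · simp [sg, hx, hy]

theorem sg_nonneg_of {E : Fin m → Fin m → ℕ} (hE : ∀ a b, E a b = E b a) {x y : Fin m}
    (h : E x y = 0) (hxy : x ≠ y) {d : Fin m → ℤ} (hd : 0 ≤ d)
    (h2 : 0 ≤ sg E y (sg E x d)) : 0 ≤ sg E x d := by
  intro z
  by_cases hz : z = x
  · subst hz
    have := h2 z
    simpa [sg, hxy] using this
  · simpa [sg, hz] using hd z

theorem AnnV.swap {E : Fin m → Fin m → ℕ} (hE : ∀ a b, E a b = E b a) {x y : Fin m}
    (h : E x y = 0) (B : List (Fin m)) (d : Fin m → ℤ) (hA : AnnV E (x :: y :: B) d) :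
    AnnV E (y :: x :: B) d := by
  by_cases hxy : x = y
  · subst hxy; exact hA
  by_cases hd : 0 ≤ d
  · by_cases h2 : 0 ≤ sg E y (sg E x d)
    · rcases hA with h0 | h0 | h0
      · exact absurd hd h0
      · exact absurd (sg_nonneg_of hE h hxy hd h2) h0
      · right; right
        rw [sg_comm hE h]; exact h0
    · right; right
      apply AnnV.of_neg
      rw [sg_comm hE h]; exact h2
  · exact Or.inl hd

theorem AnnV.swapRel {E : Fin m → Fin m → ℕ} (hE : ∀ a b, E a b = E b a)
    {S T : List (Fin m)} (h : SwapRel E S T) : ∀ d, AnnV E S d → AnnV E T d := by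
  obtain ⟨l₁, l₂, a, b, hab⟩ := h
  induction l₁ with
  | nil => intro d hd; exact AnnV.swap hE hab l₂ d hd
  | cons c l ih =>
    intro d hd
    rcases hd with hd | hd
    · exact Or.inl hd
    · exact Or.inr (ih _ hd)

theorem AnnV.sim {E : Fin m → Fin m → ℕ} (hE : ∀ a b, E a b = E b a)
    {S T : List (Fin m)} (h : Sim E S T) (d) (hA : AnnV E S d) : AnnV E T d := by
  induction h with
  | refl => exact hA
  | tail _ h2 ih => exact AnnV.swapRel hE h2 d ih

theorem Sim.perm {E : Fin m → Fin m → ℕ} {S T : List (Fin m)} (h : Sim E S T) : S.Perm T := by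
  induction h with
  | refl => exact List.Perm.refl _
  | tail _ h2 ih =>
    refine ih.trans ?_
    obtain ⟨l₁, l₂, a, b, hab⟩ := h2
    exact (List.Perm.swap b a l₂).append_left l₁

theorem Sim.cons {E : Fin m → Fin m → ℕ} {S T : List (Fin m)} (x : Fin m) (h : Sim E S T) :
    Sim E (x :: S) (x :: T) := by
  induction h with
  | refl => exact Relation.ReflTransGen.refl
  | tail _ h2 ih =>
    refine ih.tail ?_
    obtain ⟨l₁, l₂, a, b, hab⟩ := h2
    exact SwapRel.swap (x :: l₁) l₂ a b hab

theorem sink_flip {Λ : Fin m → Fin m → ℕ} {x y : Fin m} (hE : edges Λ x y = 0) (hxy : x ≠ y) :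
    IsSink (flipO x Λ) y ↔ IsSink Λ y := by
  simp only [edges] at hE
  have h1 : Λ x y = 0 := by omega
  have h2 : Λ y x = 0 := by omega
  constructor
  · intro h z
    by_cases hz : z = x
    · subst hz; exact h2
    · have := h z
      simpa [flipO, Ne.symm hxy, hz] using this
  · intro h z
    by_cases hz : z = x
    · subst hz; simp [flipO, h1]
    · simpa [flipO, Ne.symm hxy, hz] using h z

/-- two adjacent vertices are not both sinks -/
theorem not_adj_sinks {Λ : Fin m → Fin m → ℕ} {x y : Fin m} (hx : IsSink Λ x) (hy : IsSink Λ y) :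
    edges Λ x y = 0 := by simp [edges, hx y, hy x]

theorem extract : ∀ (T : List (Fin m)) (Λ : Fin m → Fin m → ℕ) (x : Fin m), IsSink Λ x →
    Admissible Λ T → x ∈ T → ∃ T', Sim (edges Λ) T (x :: T') ∧ Admissible Λ (x :: T') := by
  intro T
  induction T with
  | nil => intro Λ x _ _ h; simp at h
  | cons y T ih =>
    intro Λ x hx hT hm
    by_cases hxy : x = y
    · subst hxy; exact ⟨T, Relation.ReflTransGen.refl, hT⟩
    · have hm' : x ∈ T := by simpa [hxy] using hm
      obtain ⟨hy, hT⟩ := hT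
      have hE := not_adj_sinks hy hx
      obtain ⟨T', h1, h2⟩ := ih (flipO y Λ) x ((sink_flip hE (Ne.symm hxy)).2 hx) hT hm'
      rw [edges_flip] at h1
      refine ⟨y :: T', (Sim.cons y h1).tail (SwapRel.swap [] T' y x hE), hx, ?_, ?_⟩
      · exact (sink_flip (not_adj_sinks hx hy) hxy).2 hy
      · rw [flip_comm]; exact h2.2

theorem preceq_of_count : ∀ (S T : List (Fin m)) (Λ : Fin m → Fin m → ℕ), Admissible Λ S →
    Admissible Λ T → (∀ z, S.count z ≤ T.count z) → Preceq Λ S T := by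
  intro S
  induction S with
  | nil => intro T Λ _ hT _; exact ⟨T, hT, Relation.ReflTransGen.refl⟩
  | cons x S ih =>
    intro T Λ hS hT hc
    have hx : x ∈ T := by
      have := hc x
      rw [List.count_cons_self] at this
      exact List.count_pos_iff.1 (by omega)
    obtain ⟨T', h1, h2⟩ := extract T Λ x hS.1 hT hx
    obtain ⟨U, hU1, hU2⟩ := ih T' (flipO x Λ) hS.2 h2.2 (by
      intro z
      have := hc z
      rw [h1.perm.count_eq, List.count_cons, List.count_cons] at this
      omega)
    refine ⟨U, hU1, ?_⟩
    rw [edges_flip] at hU2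
    exact Relation.ReflTransGen.trans h1 (Sim.cons x hU2)

theorem count_of_preceq {S T : List (Fin m)} {Λ : Fin m → Fin m → ℕ} (h : Preceq Λ S T) (z) :
    S.count z ≤ T.count z := by
  obtain ⟨U, _, h2⟩ := h
  rw [h2.perm.count_eq, List.count_append]; omega

/-- If a sink `x` does not occur in the admissible `T`, then neither do its neighbours, and `T`
is admissible after flipping `x`. -/
theorem not_mem_nbr : ∀ (T : List (Fin m)) (Λ : Fin m → Fin m → ℕ) (x : Fin m), IsSink Λ x →
    Admissible Λ T → x ∉ T → (∀ y, edges Λ x y ≠ 0 → y ∉ T) := by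
  intro T
  induction T with
  | nil => intro Λ x _ _ _ y _; simp
  | cons w T ih =>
    intro Λ x hx hT hm y hy
    have hxw : x ≠ w := fun h => hm (by simp [h])
    have hE := not_adj_sinks hT.1 hx
    have h1 := ih (flipO w Λ) x ((sink_flip hE (Ne.symm hxw)).2 hx) hT.2
      (fun h => hm (by simp [h])) y (by rwa [edges_flip])
    rw [List.mem_cons, not_or]
    refine ⟨?_, h1⟩
    rintro rfl
    rw [edges_symm] at hE; exact hy hE

theorem adm_flip : ∀ (T : List (Fin m)) (Λ : Fin m → Fin m → ℕ) (x : Fin m),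
    (∀ y ∈ T, y ≠ x ∧ edges Λ x y = 0) → (Admissible (flipO x Λ) T ↔ Admissible Λ T) := by
  intro T
  induction T with
  | nil => intro Λ x _; simp [Admissible]
  | cons w T ih =>
    intro Λ x h
    have hw := h w (by simp)
    simp only [Admissible]
    rw [sink_flip hw.2 hw.1.symm, flip_comm, ih]
    intro y hy
    rw [edges_flip]
    exact h y (by simp [hy])

/-- the unit vector -/
def ev (x : Fin m) : Fin m → ℤ := fun z => if z = x then 1 else 0

theorem sg_ev_neg {E : Fin m → Fin m → ℕ} {x : Fin m} (h : E x x = 0) :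
    ¬ 0 ≤ sg E x (ev x) := by
  intro h0
  have := h0 x
  have e : ∑ y, (E x y : ℤ) * ev x y = 0 := by
    apply Finset.sum_eq_zero
    intro y _
    by_cases hy : y = x
    · subst hy; simp [h]
    · simp [ev, hy]
  simp only [sg, if_true, e] at this
  simp [ev] at this

/-- Closure hypotheses for a class of dimension vectors. -/
structure DimClass (D : (Fin m → Fin m → ℕ) → (Fin m → ℤ) → Prop) : Prop where
  nonneg : ∀ Λ d, D Λ d → 0 ≤ d
  step : ∀ Λ d x, D Λ d → IsSink Λ x → d = ev x ∨ D (flipO x Λ) (sg (edges Λ) x d)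

theorem sink_loop {Λ : Fin m → Fin m → ℕ} {x : Fin m} (h : IsSink Λ x) : edges Λ x x = 0 := by
  simp [edges, h x]

theorem dim_zero_of_not_mem {D : (Fin m → Fin m → ℕ) → (Fin m → ℤ) → Prop} (hD : DimClass D) :
    ∀ (T : List (Fin m)) (Λ : Fin m → Fin m → ℕ) (d : Fin m → ℤ), D Λ d → Admissible Λ T →
    AnnV (edges Λ) T d → ∀ z, z ∉ T → d z = 0 := by
  intro T
  induction T with
  | nil => intro Λ d hd _ hA; exact absurd (hD.nonneg _ _ hd) hA
  | cons x T ih =>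
    intro Λ d hd hT hA z hz
    have hzx : z ≠ x := fun h => hz (by simp [h])
    rcases hD.step _ _ x hd hT.1 with h | h
    · simp [h, ev, hzx]
    · rcases hA with hA | hA
      · exact absurd (hD.nonneg _ _ hd) hA
      · have := ih _ _ h hT.2 (by rwa [edges_flip]) z (fun h => hz (by simp [h]))
        simpa [sg, hzx] using this

theorem meet_exists {D : (Fin m → Fin m → ℕ) → (Fin m → ℤ) → Prop} (hD : DimClass D) :
    ∀ (S T : List (Fin m)) (Λ : Fin m → Fin m → ℕ) (d : Fin m → ℤ), D Λ d → Admissible Λ S →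
    Admissible Λ T → AnnV (edges Λ) S d → AnnV (edges Λ) T d →
    ∃ R, Admissible Λ R ∧ AnnV (edges Λ) R d ∧ ∀ z, R.count z ≤ S.count z ∧
      R.count z ≤ T.count z := by
  intro S
  induction S with
  | nil => intro T Λ d hd _ _ hA; exact absurd (hD.nonneg _ _ hd) hA
  | cons x S ih =>
    intro T Λ d hd hS hT hAS hAT
    have hx := hS.1
    rcases hD.step _ _ x hd hx with h | h
    · have hxT : x ∈ T := by
        by_contra hc
        have := dim_zero_of_not_mem hD T Λ d hd hT hAT x hc
        simp [h, ev] at this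
      refine ⟨[x], ⟨hx, trivial⟩, Or.inr ?_, ?_⟩
      · rw [h]; exact sg_ev_neg (sink_loop hx)
      · intro z
        have h1 : 0 < T.count x := List.count_pos_iff.2 hxT
        by_cases hz : z = x
        · subst hz; simp; omega
        · have hz' : ¬ x = z := fun h => hz h.symm
          simp [hz']
    · have hAS' : AnnV (edges Λ) S (sg (edges Λ) x d) := by
        rcases hAS with hA | hA
        · exact absurd (hD.nonneg _ _ hd) hA
        · exact hA
      by_cases hxT : x ∈ T
      · obtain ⟨T', h1, h2⟩ := extract T Λ x hx hT hxT
        have hAT' : AnnV (edges Λ) T' (sg (edges Λ) x d) := by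
          rcases AnnV.sim (edges_symm Λ) h1 d hAT with hA | hA
          · exact absurd (hD.nonneg _ _ hd) hA
          · exact hA
        obtain ⟨R, r1, r2, r3⟩ := ih T' (flipO x Λ) _ h hS.2 h2.2 (by rwa [edges_flip])
          (by rwa [edges_flip])
        rw [edges_flip] at r2
        refine ⟨x :: R, ⟨hx, r1⟩, Or.inr r2, ?_⟩
        intro z
        have := r3 z
        rw [h1.perm.count_eq, List.count_cons, List.count_cons, List.count_cons]
        omega
      · have hn := not_mem_nbr T Λ x hx hT hxT
        have d0 := dim_zero_of_not_mem hD T Λ d hd hT hAT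
        have hsd : sg (edges Λ) x d = d := by
          funext z
          by_cases hz : z = x
          · subst hz
            simp only [sg, if_true, d0 z hxT, sub_zero]
            apply Finset.sum_eq_zero
            intro y _
            by_cases hy : edges Λ z y = 0
            · simp [hy]
            · simp [d0 y (hn y hy)]
          · simp [sg, hz]
        have hadm : ∀ R : List (Fin m), (∀ z, R.count z ≤ T.count z) →
            ∀ y ∈ R, y ≠ x ∧ edges Λ x y = 0 := by
          intro R hR y hy
          have hyT : y ∈ T := List.count_pos_iff.1
            (lt_of_lt_of_le (List.count_pos_iff.2 hy) (hR y))
          refine ⟨?_, ?_⟩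
          · rintro rfl; exact hxT hyT
          · by_contra hc; exact hn y hc hyT
        obtain ⟨R, r1, r2, r3⟩ := ih T (flipO x Λ) _ h hS.2
          ((adm_flip T Λ x (hadm T fun _ => le_rfl)).2 hT) (by rwa [edges_flip])
          (by rw [edges_flip, hsd]; exact hAT)
        rw [edges_flip, hsd] at r2
        refine ⟨R, (adm_flip R Λ x (hadm R fun z => (r3 z).2)).1 r1, r2, ?_⟩
        intro z
        have := r3 z
        rw [List.count_cons]
        omega

end Comb

section Lin
variable {K : Type} [Field K] {m : ℕ} {Λ : Fin m → Fin m → ℕ}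

/-- Arrow maps indexed by all natural numbers (zero beyond the number of arrows). -/
def Rep.F (M : Rep K m Λ) (a b : Fin m) (i : ℕ) : (Fin (M.d a) → K) →ₗ[K] (Fin (M.d b) → K) :=
  if h : i < Λ a b then M.f a b ⟨i, h⟩ else 0

theorem Rep.F_fin (M : Rep K m Λ) (a b : Fin m) (i : Fin (Λ a b)) : M.F a b i = M.f a b i := by
  simp [Rep.F]

theorem Rep.F_zero (M : Rep K m Λ) {a b : Fin m} (h : Λ a b = 0) (i : ℕ) : M.F a b i = 0 := by
  simp [Rep.F, h]

/-- hom from natural-number-indexed commutation -/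
def mkHom {M N : Rep K m Λ} (g : ∀ x, (Fin (M.d x) → K) →ₗ[K] (Fin (N.d x) → K))
    (h : ∀ a b i v, g b (M.F a b i v) = N.F a b i (g a v)) : RepHom M N where
  g := g
  comm a b i v := by
    have := h a b i v
    rwa [Rep.F_fin, Rep.F_fin] at this

theorem RepHom.commF {M N : Rep K m Λ} (h : RepHom M N) (a b i v) :
    h.g b (M.F a b i v) = N.F a b i (h.g a v) := by
  unfold Rep.F
  split
  · exact h.comm a b _ v
  · simp

def RepHom.id' (M : Rep K m Λ) : RepHom M M := ⟨fun _ => LinearMap.id, fun _ _ _ _ => rfl⟩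

def RepHom.comp' {M N P : Rep K m Λ} (g : RepHom N P) (f : RepHom M N) : RepHom M P :=
  ⟨fun x => g.g x ∘ₗ f.g x, fun a b i v => by simp [f.comm, g.comm]⟩

def RepHom.Bij {M N : Rep K m Λ} (f : RepHom M N) : Prop := ∀ x, Function.Bijective (f.g x)

def RepHom.NZ {M N : Rep K m Λ} (f : RepHom M N) : Prop := ∃ x v, f.g x v ≠ 0

theorem repIso_iff {M N : Rep K m Λ} : RepIso M N ↔ ∃ f : RepHom M N, f.Bij := by
  constructor
  · rintro ⟨g, hg⟩
    exact ⟨⟨fun x => (g x).toLinearMap, hg⟩, fun x => (g x).bijective⟩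
  · rintro ⟨f, hf⟩
    exact ⟨fun x => LinearEquiv.ofBijective (f.g x) (hf x), f.comm⟩

theorem RepHom.Bij.inv {M N : Rep K m Λ} {f : RepHom M N} (hf : f.Bij) :
    ∃ g : RepHom N M, (∀ x v, g.g x (f.g x v) = v) ∧ (∀ x v, f.g x (g.g x v) = v) := by
  let e := fun x => LinearEquiv.ofBijective (f.g x) (hf x)
  refine ⟨⟨fun x => (e x).symm.toLinearMap, ?_⟩, ?_, ?_⟩
  · intro a b i v
    apply (e b).injective
    have h1 := f.comm a b i ((e a).symm v)
    have h2 : f.g a ((e a).symm v) = v := (e a).apply_symm_apply v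
    rw [h2] at h1
    show (e b) ((e b).symm _) = f.g b _
    rw [LinearEquiv.apply_symm_apply]
    exact h1.symm
  · intro x v; exact (e x).symm_apply_apply v
  · intro x v; exact (e x).apply_symm_apply v

theorem bij_of_inv {M N : Rep K m Λ} {f : RepHom M N} {g : RepHom N M}
    (h1 : ∀ x v, g.g x (f.g x v) = v) (h2 : ∀ x v, f.g x (g.g x v) = v) : f.Bij :=
  fun x => ⟨Function.LeftInverse.injective (h1 x), Function.RightInverse.surjective (h2 x)⟩

theorem RepIso.symm' {M N : Rep K m Λ} (h : RepIso M N) : RepIso N M := by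
  obtain ⟨f, hf⟩ := repIso_iff.1 h
  obtain ⟨g, h1, h2⟩ := hf.inv
  exact repIso_iff.2 ⟨g, bij_of_inv h2 h1⟩

theorem RepIso.trans' {M N P : Rep K m Λ} (h : RepIso M N) (h' : RepIso N P) : RepIso M P := by
  obtain ⟨f, hf⟩ := repIso_iff.1 h
  obtain ⟨g, hg⟩ := repIso_iff.1 h'
  exact repIso_iff.2 ⟨g.comp' f, fun x => (hg x).comp (hf x)⟩

theorem RepIso.dim {M N : Rep K m Λ} (h : RepIso M N) (z) : M.d z = N.d z := by
  obtain ⟨g, _⟩ := h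
  simpa using (g z).finrank_eq

/-- Idempotent formulation of indecomposability. -/
def Indec (M : Rep K m Λ) : Prop :=
  ¬ IsZeroRep M ∧ ∀ e : RepHom M M, (∀ x v, e.g x (e.g x v) = e.g x v) →
    (∀ x v, e.g x v = 0) ∨ (∀ x v, e.g x v = v)

/-- The restriction to an invariant family of subspaces. -/
noncomputable def subRep (M : Rep K m Λ) (W : ∀ z, Submodule K (Fin (M.d z) → K))
    (hW : ∀ a b i, ∀ v ∈ W a, M.f a b i v ∈ W b) : Rep K m Λ where
  d z := Module.finrank K (W z)
  f a b i := (Module.finBasis K (W b)).equivFun.toLinearMap ∘ₗ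
    ((M.f a b i).restrict (hW a b i)) ∘ₗ (Module.finBasis K (W a)).equivFun.symm.toLinearMap

theorem indec_of_indecomp {M : Rep K m Λ} (hM : Indecomp M) : Indec M := by
  refine ⟨hM.1, fun e he => ?_⟩
  have hW1 : ∀ a b i, ∀ v ∈ LinearMap.range (e.g a), M.f a b i v ∈ LinearMap.range (e.g b) := by
    rintro a b i _ ⟨v, rfl⟩
    exact ⟨M.f a b i v, e.comm a b i v⟩
  have hW2 : ∀ a b i, ∀ v ∈ LinearMap.ker (e.g a), M.f a b i v ∈ LinearMap.ker (e.g b) := by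
    intro a b i v hv
    rw [LinearMap.mem_ker] at hv ⊢
    rw [e.comm, hv, map_zero]
  have hc : ∀ z, IsCompl (LinearMap.range (e.g z)) (LinearMap.ker (e.g z)) := by
    intro z
    have : IsIdempotentElem (e.g z) := LinearMap.ext (he z)
    exact LinearMap.IsIdempotentElem.isCompl this
  let A := subRep M _ hW1
  let B := subRep M _ hW2
  let ψ : ∀ z, ((Fin (A.d z) → K) × (Fin (B.d z) → K)) ≃ₗ[K] (Fin (M.d z) → K) := fun z =>
      ((LinearEquiv.prodCongr (Module.finBasis K (LinearMap.range (e.g z))).equivFun.symm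
        (Module.finBasis K (LinearMap.ker (e.g z))).equivFun.symm).trans
        (Submodule.prodEquivOfIsCompl _ _ (hc z)))
  have hψ : ∀ z v1 v2, ψ z (v1, v2) =
      ((Module.finBasis K (LinearMap.range (e.g z))).equivFun.symm v1 : Fin (M.d z) → K) +
      ((Module.finBasis K (LinearMap.ker (e.g z))).equivFun.symm v2 : Fin (M.d z) → K) := by
    intro z v1 v2
    rfl
  have hA : ∀ a b i v, ((Module.finBasis K (LinearMap.range (e.g b))).equivFun.symm
      (A.f a b i v) : Fin (M.d b) → K) = M.f a b i
      ((Module.finBasis K (LinearMap.range (e.g a))).equivFun.symm v : Fin (M.d a) → K) := by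
    intro a b i v
    show (((Module.finBasis K (LinearMap.range (e.g b))).equivFun.symm
      ((Module.finBasis K (LinearMap.range (e.g b))).equivFun _) : _) : Fin (M.d b) → K) = _
    rw [LinearEquiv.symm_apply_apply]; rfl
  have hB : ∀ a b i v, ((Module.finBasis K (LinearMap.ker (e.g b))).equivFun.symm
      (B.f a b i v) : Fin (M.d b) → K) = M.f a b i
      ((Module.finBasis K (LinearMap.ker (e.g a))).equivFun.symm v : Fin (M.d a) → K) := by
    intro a b i v
    show (((Module.finBasis K (LinearMap.ker (e.g b))).equivFun.symm
      ((Module.finBasis K (LinearMap.ker (e.g b))).equivFun _) : _) : Fin (M.d b) → K) = _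
    rw [LinearEquiv.symm_apply_apply]; rfl
  have hiso : RepIso (dSum A B) M := by
    refine ⟨fun z => (splitL K (A.d z) (B.d z)).trans (ψ z), ?_⟩
    intro a b i v
    show ψ b ((splitL K (A.d b) (B.d b)) ((splitL K (A.d b) (B.d b)).symm
      (LinearMap.prodMap (A.f a b i) (B.f a b i) (splitL K (A.d a) (B.d a) v)))) =
      M.f a b i (ψ a (splitL K (A.d a) (B.d a) v))
    rw [LinearEquiv.apply_symm_apply]
    generalize (splitL K (A.d a) (B.d a) v) = w
    obtain ⟨v1, v2⟩ := w
    rw [LinearMap.prodMap_apply, hψ, hψ, map_add, hA, hB]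
  rcases hM.2 A B hiso.symm' with h | h
  · left
    intro z v
    have h0 : Module.finrank K (LinearMap.range (e.g z)) = 0 := h z
    rw [Submodule.finrank_eq_zero] at h0
    rw [LinearMap.range_eq_bot.1 h0]; rfl
  · right
    intro z v
    have h0 : Module.finrank K (LinearMap.ker (e.g z)) = 0 := h z
    rw [Submodule.finrank_eq_zero] at h0
    exact LinearMap.ker_eq_bot.1 h0 (he z v)

theorem indecomp_of_indec {M : Rep K m Λ} (hM : Indec M) : Indecomp M := by
  refine ⟨hM.1, fun A B hiso => ?_⟩
  obtain ⟨f, hf⟩ := repIso_iff.1 hiso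
  obtain ⟨g, h1, h2⟩ := hf.inv
  obtain ⟨σ, hσ⟩ : ∃ σ : ∀ z, (Fin ((dSum A B).d z) → K) ≃ₗ[K]
      ((Fin (A.d z) → K) × (Fin (B.d z) → K)), ∀ a b i v,
      σ b ((dSum A B).f a b i v) = (A.f a b i (σ a v).1, B.f a b i (σ a v).2) := by
    refine ⟨fun z => splitL K (A.d z) (B.d z), ?_⟩
    intro a b i v
    exact LinearEquiv.apply_symm_apply (splitL K (A.d b) (B.d b)) _
  let p : RepHom (dSum A B) (dSum A B) :=
    { g := fun z => (σ z).symm.toLinearMap ∘ₗ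
        (LinearMap.prodMap LinearMap.id 0) ∘ₗ (σ z).toLinearMap
      comm := by
        intro a b i v
        apply (σ b).injective
        simp [hσ, LinearMap.prodMap_apply] }
  have hp : ∀ z v, p.g z (p.g z v) = p.g z v := by
    intro z v; simp [p, LinearMap.prodMap_apply]
  rcases hM.2 (g.comp' (p.comp' f)) (by
    intro z v
    simp only [RepHom.comp', LinearMap.comp_apply, h2, hp]) with h | h
  · left
    have h0 : ∀ z w, p.g z w = 0 := by
      intro z w
      have := congrArg (f.g z) (h z (g.g z w))
      simpa only [RepHom.comp', LinearMap.comp_apply, h2, map_zero] using this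
    intro z
    by_contra hz
    have hpos : 0 < A.d z := Nat.pos_of_ne_zero hz
    have := congrArg (fun w => (σ z w).1) (h0 z ((σ z).symm (fun _ => 1, 0)))
    simp only [p, LinearMap.prodMap_apply, LinearMap.comp_apply, LinearEquiv.coe_coe,
      LinearEquiv.apply_symm_apply, map_zero, LinearMap.id_apply] at this
    exact one_ne_zero (congrFun this ⟨0, hpos⟩)
  · right
    have h0 : ∀ z w, p.g z w = w := by
      intro z w
      have := congrArg (f.g z) (h z (g.g z w))
      simpa only [RepHom.comp', LinearMap.comp_apply, h2] using this
    intro z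
    by_contra hz
    have hpos : 0 < B.d z := Nat.pos_of_ne_zero hz
    have := congrArg (fun w => (σ z w).2) (h0 z ((σ z).symm (0, fun _ => 1)))
    simp only [p, LinearMap.prodMap_apply, LinearMap.comp_apply, LinearEquiv.coe_coe,
      LinearEquiv.apply_symm_apply, LinearMap.zero_apply] at this
    exact one_ne_zero (congrFun this.symm ⟨0, hpos⟩)

theorem indec_iff {M : Rep K m Λ} : Indecomp M ↔ Indec M := ⟨indec_of_indecomp, indecomp_of_indec⟩

/-- glue a dependent family -/
theorem glue {P : Fin m → Type} (x : Fin m) (a : P x) (b : ∀ z, z ≠ x → P z) :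
    ∃ f : ∀ z, P z, f x = a ∧ ∀ z hz, f z = b z hz := by
  refine ⟨fun z => if h : z = x then h ▸ a else b z h, ?_, ?_⟩
  · simp
  · intro z hz; simp [hz]

end Lin

section Refl
variable {K : Type} [Field K] {m : ℕ} {Λ : Fin m → Fin m → ℕ}

/-- `M'` is obtained from `M` by reflecting at `x`. -/
structure Refl (x : Fin m) (M : Rep K m Λ) (M' : Rep K m (flipO x Λ)) where
  e : ∀ z, z ≠ x → (Fin (M.d z) → K) ≃ₗ[K] (Fin (M'.d z) → K)
  comm : ∀ a b (ha : a ≠ x) (hb : b ≠ x) i v,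
    e b hb (M.F a b i v) = M'.F a b i (e a ha v)
  J : (Fin (M'.d x) → K) →ₗ[K] ((p : Arin Λ x) → (Fin (M.d p.1) → K))
  Jinj : Function.Injective J
  Jrange : ∀ w, inMap Λ M x w = 0 ↔ ∃ u, J u = w
  Jcomm : ∀ (p : Arin Λ x) (hp : p.1 ≠ x) u, e p.1 hp (J u p) = M'.F x p.1 p.2 u

/-- the map into `x` is onto -/
def Good (x : Fin m) (M : Rep K m Λ) : Prop := Function.Surjective (inMap Λ M x)

theorem inMap_apply (M : Rep K m Λ) (x : Fin m) (w) :
    inMap Λ M x w = ∑ p : Arin Λ x, M.f p.1 x p.2 (w p) := by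
  simp [inMap]

theorem inMap_single (M : Rep K m Λ) (x : Fin m) (p : Arin Λ x) (v) :
    inMap Λ M x (Pi.single p v) = M.f p.1 x p.2 v := by
  rw [inMap_apply, Finset.sum_eq_single p]
  · simp
  · intro q _ hq; rw [Pi.single_eq_of_ne hq, map_zero]
  · simp

theorem arin_ne {x : Fin m} (hx : IsSink Λ x) (p : Arin Λ x) : p.1 ≠ x := by
  intro h
  have := p.2.2
  have h0 : Λ p.1 x = 0 := by rw [h]; exact hx x
  omega

theorem flip_out (x b : Fin m) (Λ : Fin m → Fin m → ℕ) : flipO x Λ x b = Λ b x := by simp [flipO]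
theorem flip_in (x b : Fin m) (Λ : Fin m → Fin m → ℕ) : flipO x Λ b x = Λ x b := by simp [flipO]

theorem hom_inMap {M N : Rep K m Λ} (h : RepHom M N) (x : Fin m) (w) :
    h.g x (inMap Λ M x w) = inMap Λ N x (fun p => h.g p.1 (w p)) := by
  rw [inMap_apply, inMap_apply, map_sum]
  exact Finset.sum_congr rfl fun p _ => h.comm _ _ _ _

/-- related homs -/
def Rel {x : Fin m} {M N : Rep K m Λ} {M' N' : Rep K m (flipO x Λ)} (R : Refl x M M')
    (R2 : Refl x N N') (h : RepHom M N) (h' : RepHom M' N') : Prop :=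
  ∀ z hz v, h'.g z (R.e z hz v) = R2.e z hz (h.g z v)

theorem lift_sub {A B C : Type} [AddCommGroup A] [Module K A] [AddCommGroup B] [Module K B]
    [AddCommGroup C] [Module K C] (f : A →ₗ[K] C) (hf : Function.Injective f) (g : B →ₗ[K] C)
    (h : ∀ b, ∃ a, f a = g b) : ∃ l : B →ₗ[K] A, ∀ b, f (l b) = g b := by
  obtain ⟨r, hr⟩ := f.exists_leftInverse_of_injective (LinearMap.ker_eq_bot.2 hf)
  refine ⟨r ∘ₗ g, fun b => ?_⟩
  obtain ⟨a, ha⟩ := h b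
  have : r (f a) = a := LinearMap.congr_fun hr a
  rw [LinearMap.comp_apply, ← ha, this]

theorem lift_quot {A B C : Type} [AddCommGroup A] [Module K A] [AddCommGroup B] [Module K B]
    [AddCommGroup C] [Module K C] (q : C →ₗ[K] A) (hq : Function.Surjective q) (g : C →ₗ[K] B)
    (h : ∀ c, q c = 0 → g c = 0) : ∃ l : A →ₗ[K] B, ∀ c, l (q c) = g c := by
  obtain ⟨s, hs⟩ := q.exists_rightInverse_of_surjective (LinearMap.range_eq_top.2 hq)
  refine ⟨g ∘ₗ s, fun c => ?_⟩
  have h1 : q (s (q c)) = q c := LinearMap.congr_fun hs (q c)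
  have h2 : q (s (q c) - c) = 0 := by rw [map_sub, h1, sub_self]
  have := h _ h2
  rw [map_sub, sub_eq_zero] at this
  exact this

theorem relA {x : Fin m} (hx : IsSink Λ x) {M N : Rep K m Λ} {M' N' : Rep K m (flipO x Λ)}
    (R : Refl x M M') (R2 : Refl x N N') (h : RepHom M N) : ∃ h' : RepHom M' N', Rel R R2 h h' := by
  obtain ⟨l, hl⟩ := lift_sub R2.J R2.Jinj
    (LinearMap.pi (fun p : Arin Λ x => h.g p.1 ∘ₗ LinearMap.proj p ∘ₗ R.J)) (by
      intro u
      rw [← R2.Jrange]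
      have h1 : inMap Λ M x (R.J u) = 0 := (R.Jrange _).2 ⟨u, rfl⟩
      have h2 := hom_inMap h x (R.J u)
      rw [h1, map_zero] at h2
      exact h2.symm)
  have hl' : ∀ u p, R2.J (l u) p = h.g p.1 (R.J u p) := fun u p => congrFun (hl u) p
  obtain ⟨g, g1, g2⟩ := glue (P := fun z => (Fin (M'.d z) → K) →ₗ[K] (Fin (N'.d z) → K)) x l
    (fun z hz => (R2.e z hz).toLinearMap ∘ₗ h.g z ∘ₗ (R.e z hz).symm.toLinearMap)
  have g2' : ∀ z hz v, g z (R.e z hz v) = R2.e z hz (h.g z v) := by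
    intro z hz v; rw [g2 z hz]; simp
  refine ⟨mkHom g ?_, g2'⟩
  intro a b i v
  by_cases hb : b = x
  · subst hb
    have h0 : flipO b Λ a b = 0 := by rw [flip_in]; exact hx a
    simp [Rep.F_zero _ h0]
  · by_cases ha : a = x
    · subst ha
      by_cases hi : i < Λ b a
      · have e1 := R.Jcomm ⟨b, ⟨i, hi⟩⟩ hb v
        have e2 := R2.Jcomm ⟨b, ⟨i, hi⟩⟩ hb (l v)
        simp only at e1 e2
        rw [g1, ← e1, ← e2, g2', hl']
      · have : ¬ i < flipO a Λ a b := by rw [flip_out]; exact hi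
        simp [Rep.F, this]
    · obtain ⟨w, rfl⟩ := (R.e a ha).surjective v
      rw [← R.comm a b ha hb, g2', g2', ← R2.comm a b ha hb, h.commF]

theorem relB {x : Fin m} (hx : IsSink Λ x) {M N : Rep K m Λ} {M' N' : Rep K m (flipO x Λ)}
    (R : Refl x M M') (R2 : Refl x N N') (hM : Good x M) (h : RepHom M' N') :
    ∃ h' : RepHom M N, Rel R R2 h' h := by
  have key : ∀ u p, (R2.e p.1 (arin_ne hx p)).symm (h.g p.1 (R.e p.1 (arin_ne hx p) (R.J u p))) =
      R2.J (h.g x u) p := by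
    intro u p
    rw [LinearEquiv.symm_apply_eq, R.Jcomm, R2.Jcomm, h.commF]
  obtain ⟨l, hl⟩ := lift_quot (inMap Λ M x) hM
    (inMap Λ N x ∘ₗ LinearMap.pi (fun p : Arin Λ x => (R2.e p.1 (arin_ne hx p)).symm.toLinearMap ∘ₗ
      h.g p.1 ∘ₗ (R.e p.1 (arin_ne hx p)).toLinearMap ∘ₗ LinearMap.proj p)) (by
      intro w hw
      obtain ⟨u, rfl⟩ := (R.Jrange w).1 hw
      rw [LinearMap.comp_apply, R2.Jrange]
      refine ⟨h.g x u, ?_⟩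
      funext p
      exact (key u p).symm)
  obtain ⟨g, g1, g2⟩ := glue (P := fun z => (Fin (M.d z) → K) →ₗ[K] (Fin (N.d z) → K)) x l
    (fun z hz => (R2.e z hz).symm.toLinearMap ∘ₗ h.g z ∘ₗ (R.e z hz).toLinearMap)
  have g2' : ∀ z hz v, h.g z (R.e z hz v) = R2.e z hz (g z v) := by
    intro z hz v; rw [g2 z hz]; simp
  refine ⟨mkHom g ?_, g2'⟩
  intro a b i v
  by_cases ha : a = x
  · subst ha
    simp [Rep.F_zero _ (hx b)]
  · by_cases hb : b = x
    · subst hb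
      by_cases hi : i < Λ a b
      · have e1 := hl (Pi.single ⟨a, ⟨i, hi⟩⟩ v)
        have e2 : (LinearMap.pi (fun p : Arin Λ b =>
            (R2.e p.1 (arin_ne hx p)).symm.toLinearMap ∘ₗ
            h.g p.1 ∘ₗ (R.e p.1 (arin_ne hx p)).toLinearMap ∘ₗ LinearMap.proj p))
            (Pi.single ⟨a, ⟨i, hi⟩⟩ v) = Pi.single ⟨a, ⟨i, hi⟩⟩ (g a v) := by
          funext p
          by_cases hp : p = ⟨a, ⟨i, hi⟩⟩
          · subst hp
            simp [g2 a ha]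
          · rw [Pi.single_eq_of_ne hp]
            simp [Pi.single_eq_of_ne hp]
        rw [LinearMap.comp_apply, e2, inMap_single, inMap_single] at e1
        simpa [Rep.F, hi, g1] using e1
      · simp [Rep.F, hi]
    · apply (R2.e b hb).injective
      rw [← g2', R.comm a b ha hb, R2.comm a b ha hb, ← g2', h.commF]

theorem uniq_good {x : Fin m} (hx : IsSink Λ x) {M N : Rep K m Λ} (hM : Good x M)
    {h1 h2 : RepHom M N} (h : ∀ z, z ≠ x → ∀ v, h1.g z v = h2.g z v) (z v) :
    h1.g z v = h2.g z v := by
  by_cases hz : z = x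
  · subst hz
    obtain ⟨w, rfl⟩ := hM v
    rw [hom_inMap, hom_inMap]
    congr 1
    funext p
    exact h _ (arin_ne hx p) _
  · exact h z hz v

/-- the maps out of `x` are jointly injective -/
def OutInj (x : Fin m) (M' : Rep K m (flipO x Λ)) : Prop :=
  ∀ u, (∀ b i, M'.F x b i u = 0) → u = 0

theorem Refl.outInj {x : Fin m} (hx : IsSink Λ x) {M : Rep K m Λ} {M' : Rep K m (flipO x Λ)}
    (R : Refl x M M') : OutInj x M' := by
  intro u hu
  apply R.Jinj
  rw [map_zero]
  funext p
  have := R.Jcomm p (arin_ne hx p) u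
  rw [hu] at this
  simpa using this

theorem uniq_out {x : Fin m} (hx : IsSink Λ x) {M' N' : Rep K m (flipO x Λ)} (hN : OutInj x N')
    {h1 h2 : RepHom M' N'} (h : ∀ z, z ≠ x → ∀ v, h1.g z v = h2.g z v) (z v) :
    h1.g z v = h2.g z v := by
  by_cases hz : z = x
  · subst hz
    rw [← sub_eq_zero]
    apply hN
    intro b i
    rw [map_sub, ← h1.commF, ← h2.commF, sub_eq_zero]
    by_cases hb : b = z
    · subst hb
      have h0 : flipO b Λ b b = 0 := by rw [flip_in]; exact hx b
      simp [Rep.F_zero _ h0]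
    · exact h b hb _
  · exact h z hz v

section transfer
variable {x : Fin m} (hx : IsSink Λ x) {M N : Rep K m Λ} {M' N' : Rep K m (flipO x Λ)}
  (R : Refl x M M') (R2 : Refl x N N')

theorem Rel.bij_up (hx : IsSink Λ x) {R : Refl x M M'} {R2 : Refl x N N'} {h : RepHom M N}
    {h' : RepHom M' N'} (r : Rel R R2 h h') (hb : h.Bij) : h'.Bij := by
  obtain ⟨g, g1, g2⟩ := hb.inv
  obtain ⟨g', r'⟩ := relA hx R2 R g
  refine bij_of_inv (g := g') ?_ ?_
  · refine uniq_out hx (R.outInj hx) (h1 := g'.comp' h') (h2 := RepHom.id' M') ?_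
    intro z hz v
    obtain ⟨w, rfl⟩ := (R.e z hz).surjective v
    show g'.g z (h'.g z _) = _
    rw [r z hz, r' z hz, g1]; rfl
  · refine uniq_out hx (R2.outInj hx) (h1 := h'.comp' g') (h2 := RepHom.id' N') ?_
    intro z hz v
    obtain ⟨w, rfl⟩ := (R2.e z hz).surjective v
    show h'.g z (g'.g z _) = _
    rw [r' z hz, r z hz, g2]; rfl

theorem Rel.bij_down (hx : IsSink Λ x) {R : Refl x M M'} {R2 : Refl x N N'} {h : RepHom M N}
    {h' : RepHom M' N'} (r : Rel R R2 h h') (hM : Good x M) (hN : Good x N) (hb : h'.Bij) :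
    h.Bij := by
  obtain ⟨g', g1, g2⟩ := hb.inv
  obtain ⟨g, r'⟩ := relB hx R2 R hN g'
  refine bij_of_inv (g := g) ?_ ?_
  · refine uniq_good hx hM (h1 := g.comp' h) (h2 := RepHom.id' M) ?_
    intro z hz v
    apply (R.e z hz).injective
    show R.e z hz (g.g z (h.g z _)) = _
    rw [← r' z hz, ← r z hz, g1]; rfl
  · refine uniq_good hx hN (h1 := h.comp' g) (h2 := RepHom.id' N) ?_
    intro z hz v
    apply (R2.e z hz).injective
    show R2.e z hz (h.g z (g.g z _)) = _
    rw [← r z hz, ← r' z hz, g2]; rfl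

def zeroHom (M N : Rep K m Λ) : RepHom M N := ⟨fun _ => 0, fun _ _ _ _ => by simp⟩

theorem Rel.nz_up (hx : IsSink Λ x) {R : Refl x M M'} {R2 : Refl x N N'} {h : RepHom M N}
    {h' : RepHom M' N'} (r : Rel R R2 h h') (hM : Good x M) (hb : h.NZ) : h'.NZ := by
  by_contra hc
  unfold RepHom.NZ at hc
  push Not at hc
  obtain ⟨z, v, hv⟩ := hb
  apply hv
  refine uniq_good hx hM (h1 := h) (h2 := zeroHom M N) ?_ z v
  intro z hz v
  apply (R2.e z hz).injective
  rw [← r z hz, hc]; simp [zeroHom]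

theorem Rel.nz_down (hx : IsSink Λ x) {R : Refl x M M'} {R2 : Refl x N N'} {h : RepHom M N}
    {h' : RepHom M' N'} (r : Rel R R2 h h') (hb : h'.NZ) : h.NZ := by
  by_contra hc
  unfold RepHom.NZ at hc
  push Not at hc
  obtain ⟨z, v, hv⟩ := hb
  apply hv
  refine uniq_out hx (R2.outInj hx) (h1 := h') (h2 := zeroHom M' N') ?_ z v
  intro z hz v
  obtain ⟨w, rfl⟩ := (R.e z hz).surjective v
  rw [r z hz, hc]; simp [zeroHom]

theorem Refl.iso_down (hx : IsSink Λ x) (R : Refl x M M') (R2 : Refl x N N') (hM : Good x M)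
    (hN : Good x N) (h : RepIso M' N') : RepIso M N := by
  obtain ⟨f, hf⟩ := repIso_iff.1 h
  obtain ⟨g, r⟩ := relB hx R R2 hM f
  exact repIso_iff.2 ⟨g, r.bij_down hx hM hN hf⟩

theorem zero_of (M : Rep K m Λ) : IsZeroRep M ↔ ∀ z (v : Fin (M.d z) → K), v = 0 := by
  constructor
  · intro h z v
    funext i
    have := i.2
    have := h z
    omega
  · intro h z
    by_contra hz
    exact one_ne_zero (congrFun (h z (fun _ => (1 : K))) ⟨0, Nat.pos_of_ne_zero hz⟩)

theorem Refl.zero_iff (hx : IsSink Λ x) (R : Refl x M M') (hM : Good x M) :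
    IsZeroRep M' ↔ IsZeroRep M := by
  rw [zero_of, zero_of]
  have r : Rel R R (RepHom.id' M) (RepHom.id' M') := fun z hz v => rfl
  constructor
  · intro h z v
    by_contra hv
    obtain ⟨z', v', hv'⟩ := r.nz_up hx hM ⟨z, v, hv⟩
    exact hv' (h z' v')
  · intro h z v
    by_contra hv
    obtain ⟨z', v', hv'⟩ := r.nz_down hx ⟨z, v, hv⟩
    exact hv' (h z' v')

theorem Refl.indec_iff' (hx : IsSink Λ x) (R : Refl x M M') (hM : Good x M) :
    Indec M' ↔ Indec M := by
  unfold Indec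
  rw [R.zero_iff hx hM]
  refine and_congr_right fun _ => ?_
  constructor
  · intro H e he
    obtain ⟨e', r⟩ := relA hx R R e
    rcases H e' (by
      refine uniq_out hx (R.outInj hx) (h1 := e'.comp' e') (h2 := e') ?_
      intro z hz v
      obtain ⟨w, rfl⟩ := (R.e z hz).surjective v
      show e'.g z (e'.g z _) = _
      rw [r z hz, r z hz, he]) with h | h
    · left
      refine uniq_good hx hM (h1 := e) (h2 := zeroHom M M) ?_
      intro z hz v
      apply (R.e z hz).injective
      rw [← r z hz, h]; simp [zeroHom]
    · right
      refine uniq_good hx hM (h1 := e) (h2 := RepHom.id' M) ?_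
      intro z hz v
      apply (R.e z hz).injective
      rw [← r z hz, h]; rfl
  · intro H e' he
    obtain ⟨e, r⟩ := relB hx R R hM e'
    rcases H e (by
      refine uniq_good hx hM (h1 := e.comp' e) (h2 := e) ?_
      intro z hz v
      apply (R.e z hz).injective
      show R.e z hz (e.g z (e.g z _)) = _
      rw [← r z hz, ← r z hz, he]) with h | h
    · left
      refine uniq_out hx (R.outInj hx) (h1 := e') (h2 := zeroHom M' M') ?_
      intro z hz v
      obtain ⟨w, rfl⟩ := (R.e z hz).surjective v
      rw [r z hz, h]; simp [zeroHom]
    · right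
      refine uniq_out hx (R.outInj hx) (h1 := e') (h2 := RepHom.id' M') ?_
      intro z hz v
      obtain ⟨w, rfl⟩ := (R.e z hz).surjective v
      rw [r z hz, h]; rfl

end transfer

/-- dimension vector -/
def dv (M : Rep K m Λ) : Fin m → ℤ := fun z => (M.d z : ℤ)

theorem Refl.dv_eq {x : Fin m} (hx : IsSink Λ x) {M : Rep K m Λ} {M' : Rep K m (flipO x Λ)}
    (R : Refl x M M') (hM : Good x M) : dv M' = sg (edges Λ) x (dv M) := by
  funext z
  by_cases hz : z = x
  · subst hz
    have h1 := LinearMap.finrank_range_add_finrank_ker (inMap Λ M z)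
    rw [LinearMap.range_eq_top.2 hM, finrank_top] at h1
    have h2 : LinearMap.ker (inMap Λ M z) = LinearMap.range R.J := by
      ext w; rw [LinearMap.mem_ker, R.Jrange]; rfl
    rw [h2, LinearMap.finrank_range_of_inj R.Jinj,
      Module.finrank_fin_fun, Module.finrank_fin_fun, Module.finrank_pi_fintype] at h1
    simp only [Module.finrank_fin_fun] at h1
    rw [Fintype.sum_sigma] at h1
    simp only [Finset.sum_const, Finset.card_univ, Fintype.card_fin, smul_eq_mul] at h1
    simp only [sg, if_true, dv, edges, hx _, zero_add]
    have h3 : ((M.d z + M'.d z : ℕ) : ℤ) = ∑ y, (Λ y z : ℤ) * (M.d y : ℤ) := by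
      rw [h1]; push_cast; rfl
    push_cast at h3
    linarith
  · have := (R.e z hz).finrank_eq
    simp only [Module.finrank_fin_fun] at this
    simp [sg, hz, dv, this]

end Refl

section Exist
variable {K : Type} [Field K] {m : ℕ} {Λ : Fin m → Fin m → ℕ}

theorem flip_off {x a b : Fin m} (ha : a ≠ x) (hb : b ≠ x) : flipO x Λ a b = Λ a b := by
  simp [flipO, ha, hb]

theorem castL_castL {a b : ℕ} (h : a = b) (h' : b = a) (v : Fin a → K) :
    castL K h' (castL K h v) = v := by
  subst h; rfl

noncomputable def reflPlusRefl (x : Fin m) (hx : IsSink Λ x) (M : Rep K m Λ) :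
    Refl x M (reflPlus x Λ M) where
  e z hz := castL K (if_neg hz).symm
  comm a b ha hb i v := by
    by_cases hi : i < Λ a b
    · have hi' : i < flipO x Λ a b := by rw [flip_off ha hb]; exact hi
      rw [Rep.F, dif_pos hi, Rep.F, dif_pos hi']
      simp only [reflPlus, dif_neg ha, dif_neg hb]
      exact congrArg _ (congrArg (M.f a b ⟨i, hi⟩) (castL_castL (if_neg ha).symm (if_neg ha) v).symm)
    · have hi' : ¬ i < flipO x Λ a b := by rw [flip_off ha hb]; exact hi
      rw [Rep.F, dif_neg hi, Rep.F, dif_neg hi']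
      simp
  J := (LinearMap.ker (inMap Λ M x)).subtype ∘ₗ
          (kerEquiv Λ M x).symm.toLinearMap ∘ₗ (castL K (if_pos rfl)).toLinearMap
  Jinj := by
    intro u v h
    simp only [LinearMap.comp_apply, LinearEquiv.coe_coe] at h
    exact (castL K _).injective ((kerEquiv Λ M x).symm.injective (Subtype.val_injective h))
  Jrange w := by
    constructor
    · intro h
      obtain ⟨u, hu⟩ := ((castL K (if_pos rfl : (reflPlus x Λ M).d x = _)).trans
        (kerEquiv Λ M x).symm).surjective ⟨w, h⟩
      refine ⟨u, ?_⟩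
      have := congrArg Subtype.val hu
      exact this
    · rintro ⟨u, rfl⟩
      exact ((kerEquiv Λ M x).symm _).2
  Jcomm p hp u := by
    have hi' : (p.2 : ℕ) < flipO x Λ x p.1 := by rw [flip_out]; exact p.2.2
    rw [Rep.F, dif_pos hi']
    simp only [reflPlus, dif_pos rfl, dif_neg hp]
    rfl

/-- arrows into `x` become arrows out of `x` -/
def tau (x : Fin m) (Λ : Fin m → Fin m → ℕ) : Arin Λ x ≃ Aout (flipO x Λ) x where
  toFun p := ⟨p.1, Fin.cast (flip_out x p.1 Λ).symm p.2⟩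
  invFun q := ⟨q.1, Fin.cast (flip_out x q.1 Λ) q.2⟩
  left_inv _ := rfl
  right_inv _ := rfl

/-- reindexing of families along `tau` -/
def tauL (x : Fin m) (N : Rep K m (flipO x Λ)) :
    ((p : Arin Λ x) → (Fin (N.d p.1) → K)) →ₗ[K]
      ((q : Aout (flipO x Λ) x) → (Fin (N.d q.1) → K)) where
  toFun W q := W ((tau x Λ).symm q)
  map_add' _ _ := rfl
  map_smul' _ _ := rfl

noncomputable def rmE {x : Fin m} (N : Rep K m (flipO x Λ)) (z : Fin m) (hz : z ≠ x) :
    (Fin ((reflMinus x Λ N).d z) → K) ≃ₗ[K] (Fin (N.d z) → K) := castL K (if_neg hz)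

noncomputable def rmC {x : Fin m} (N : Rep K m (flipO x Λ)) :
    (((p : Aout (flipO x Λ) x) → (Fin (N.d p.1) → K)) ⧸
        LinearMap.range (outMap (flipO x Λ) N x)) ≃ₗ[K] (Fin ((reflMinus x Λ N).d x) → K) :=
  (cokerEquiv (flipO x Λ) N x).trans (castL K (if_pos rfl).symm)

noncomputable def rmP {x : Fin m} (N : Rep K m (flipO x Λ)) :
    ((p : Arin Λ x) → (Fin (N.d p.1) → K)) →ₗ[K] (Fin ((reflMinus x Λ N).d x) → K) :=
  (rmC N).toLinearMap ∘ₗ (LinearMap.range (outMap (flipO x Λ) N x)).mkQ ∘ₗ tauL x N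

theorem tauL_single {x : Fin m} (N : Rep K m (flipO x Λ)) (p : Arin Λ x) (v : Fin (N.d p.1) → K) :
    tauL x N (Pi.single p v) = Pi.single (M := fun q : Aout (flipO x Λ) x => Fin (N.d q.1) → K)
      (tau x Λ p) v := by
  funext q
  obtain ⟨r, rfl⟩ := (tau x Λ).surjective q
  by_cases h : r = p
  · subst h
    exact (Pi.single_eq_same (M := fun p : Arin Λ x => Fin (N.d p.1) → K) r v).trans
      (Pi.single_eq_same (M := fun q : Aout (flipO x Λ) x => Fin (N.d q.1) → K)
        (tau x Λ r) v).symm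
  · exact (Pi.single_eq_of_ne (M := fun p : Arin Λ x => Fin (N.d p.1) → K) h v).trans
      (Pi.single_eq_of_ne (M := fun q : Aout (flipO x Λ) x => Fin (N.d q.1) → K)
        (fun e => h ((tau x Λ).injective e)) v).symm

theorem rmP_surj {x : Fin m} (N : Rep K m (flipO x Λ)) : Function.Surjective (rmP N) := by
  intro c
  obtain ⟨c, rfl⟩ := (rmC N).surjective c
  obtain ⟨W, rfl⟩ := Submodule.mkQ_surjective _ c
  refine ⟨fun p => W (tau x Λ p), ?_⟩
  rfl

theorem rmP_zero {x : Fin m} (N : Rep K m (flipO x Λ)) (W) :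
    rmP N W = 0 ↔ ∃ u, ∀ p : Arin Λ x, N.F x p.1 p.2 u = W p := by
  have e1 : ∀ (p : Arin Λ x) u, N.F x p.1 p.2 u = N.f x p.1 (tau x Λ p).2 u := fun p u =>
    LinearMap.congr_fun (Rep.F_fin N x p.1 (tau x Λ p).2) u
  rw [rmP, LinearMap.comp_apply, LinearEquiv.coe_coe, LinearEquiv.map_eq_zero_iff,
    LinearMap.comp_apply, Submodule.mkQ_apply, Submodule.Quotient.mk_eq_zero, LinearMap.mem_range]
  refine exists_congr fun u => ?_
  constructor
  · intro h p
    rw [e1]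
    exact congrFun h (tau x Λ p)
  · intro h
    funext q
    obtain ⟨p, rfl⟩ := (tau x Λ).surjective q
    exact (e1 p u).symm.trans (h p)

theorem reflMinus_f {x : Fin m} (hx : IsSink Λ x) (N : Rep K m (flipO x Λ)) (p : Arin Λ x) (v) :
    (reflMinus x Λ N).f p.1 x p.2 v = rmP N (Pi.single p (rmE N p.1 (arin_ne hx p) v)) := by
  have hp := arin_ne hx p
  rw [rmP, LinearMap.comp_apply, LinearMap.comp_apply, tauL_single]
  simp only [reflMinus, dif_pos rfl, dif_neg hp]
  rfl

theorem reflMinus_in {x : Fin m} (hx : IsSink Λ x) (N : Rep K m (flipO x Λ)) (w) :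
    inMap Λ (reflMinus x Λ N) x w = rmP N (fun p => rmE N p.1 (arin_ne hx p) (w p)) := by
  rw [inMap_apply]
  simp only [reflMinus_f hx N]
  rw [← map_sum]
  congr 1
  exact Finset.univ_sum_single (fun p : Arin Λ x => rmE N p.1 (arin_ne hx p) (w p))

theorem reflMinus_good {x : Fin m} (hx : IsSink Λ x) (N : Rep K m (flipO x Λ)) :
    Good x (reflMinus x Λ N) := by
  intro c
  obtain ⟨W, rfl⟩ := rmP_surj N c
  refine ⟨fun p => (rmE N p.1 (arin_ne hx p)).symm (W p), ?_⟩
  rw [reflMinus_in hx N]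
  exact congrArg (rmP N) (funext fun p => LinearEquiv.apply_symm_apply _ _)

theorem reflMinusRefl {x : Fin m} (hx : IsSink Λ x) (N : Rep K m (flipO x Λ)) (hN : OutInj x N) :
    Nonempty (Refl x (reflMinus x Λ N) N) := by
  refine ⟨{
    e := fun z hz => rmE N z hz
    comm := ?_
    J := LinearMap.pi fun p => (rmE N p.1 (arin_ne hx p)).symm.toLinearMap ∘ₗ N.F x p.1 p.2
    Jinj := ?_
    Jrange := ?_
    Jcomm := ?_ }⟩
  · intro a b ha hb i v
    by_cases hi : i < Λ a b
    · have hi' : i < flipO x Λ a b := by rw [flip_off ha hb]; exact hi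
      rw [Rep.F, dif_pos hi, Rep.F, dif_pos hi']
      simp only [reflMinus, dif_neg ha, dif_neg hb]
      exact castL_castL (if_neg hb).symm (if_neg hb) _
    · have hi' : ¬ i < flipO x Λ a b := by rw [flip_off ha hb]; exact hi
      rw [Rep.F, dif_neg hi, Rep.F, dif_neg hi']
      simp
  · rw [← LinearMap.ker_eq_bot, LinearMap.ker_eq_bot']
    intro u hu
    apply hN
    intro b i
    by_cases hi : i < Λ b x
    · have := congrFun hu ⟨b, ⟨i, hi⟩⟩
      exact (LinearEquiv.map_eq_zero_iff (rmE N b (arin_ne hx ⟨b, ⟨i, hi⟩⟩)).symm).1 this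
    · have hi' : ¬ i < flipO x Λ x b := by rw [flip_out]; exact hi
      simp [Rep.F, hi']
  · intro w
    rw [reflMinus_in hx N, rmP_zero]
    refine exists_congr fun u => ?_
    constructor
    · intro h
      funext p
      exact (LinearEquiv.symm_apply_eq _).2 (h p)
    · intro h p
      exact (LinearEquiv.symm_apply_eq _).1 (congrFun h p)
  · intro p hp u
    exact LinearEquiv.apply_symm_apply _ _

/-- concentrated at `x` -/
def Conc (x : Fin m) (M : Rep K m Λ) : Prop := ∀ z, z ≠ x → M.d z = 0

theorem vec_zero {d : ℕ} (h : d = 0) (v w : Fin d → K) : v = w := by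
  subst h; exact Subsingleton.elim _ _

theorem single_hom {x : Fin m} (M : Rep K m Λ) (hx : Λ x x = 0)
    (p : (Fin (M.d x) → K) →ₗ[K] (Fin (M.d x) → K))
    (hin : ∀ a i v, p (M.f a x i v) = 0) (hout : ∀ b i v, M.f x b i (p v) = 0) :
    ∃ e : RepHom M M, e.g x = p ∧ ∀ z, z ≠ x → e.g z = 0 := by
  obtain ⟨g, g1, g2⟩ := glue (P := fun z => (Fin (M.d z) → K) →ₗ[K] (Fin (M.d z) → K)) x p
    (fun z _ => 0)
  refine ⟨⟨g, ?_⟩, g1, g2⟩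
  intro a b i v
  by_cases ha : a = x
  · subst ha
    by_cases hb : b = a
    · subst hb
      have := i.2
      omega
    · rw [g2 b hb, g1, hout]; rfl
  · rw [g2 a ha]
    by_cases hb : b = x
    · subst hb
      rw [g1, hin]; simp
    · rw [g2 b hb]; simp

theorem exists_proj {V : Type} [AddCommGroup V] [Module K V] (W : Submodule K V) :
    ∃ p : V →ₗ[K] V, (∀ v, p v ∈ W) ∧ (∀ v ∈ W, p v = v) := by
  obtain ⟨r, hr⟩ := W.subtype.exists_leftInverse_of_injective (by simp)
  refine ⟨W.subtype ∘ₗ r, fun v => (r v).2, fun v hv => ?_⟩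
  have := LinearMap.congr_fun hr ⟨v, hv⟩
  exact congrArg Subtype.val this

theorem indec_good_or_conc {x : Fin m} (hx : IsSink Λ x) {M : Rep K m Λ} (hM : Indec M) :
    Good x M ∨ Conc x M := by
  obtain ⟨q, q1, q2⟩ := exists_proj (LinearMap.range (inMap Λ M x))
  have hr : ∀ a i v, M.f a x i v ∈ LinearMap.range (inMap Λ M x) := by
    intro a i v
    exact ⟨_, inMap_single M x ⟨a, i⟩ v⟩
  obtain ⟨e, e1, e2⟩ := single_hom (x := x) M (hx x) (LinearMap.id - q) (by
      intro a i v
      simp [q2 _ (hr a i v)]) (by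
      intro b i v
      have h1 := i.2
      have h2 := hx b
      omega)
  rcases hM.2 e (by
    intro z v
    by_cases hz : z = x
    · subst hz
      rw [e1]; simp [q2 _ (q1 v)]
    · rw [e2 z hz]; rfl) with h | h
  · left
    intro v
    have := h x v
    rw [e1] at this
    have h3 : v = q v := by simpa [sub_eq_zero] using this
    have h4 := q1 v
    rw [← h3] at h4
    exact h4
  · right
    intro z hz
    by_contra hd
    have := h z (fun _ => 1)
    rw [e2 z hz] at this
    exact zero_ne_one (congrFun this ⟨0, Nat.pos_of_ne_zero hd⟩)

theorem indec_out_or_conc {x : Fin m} (hx : IsSink Λ x) {M : Rep K m (flipO x Λ)} (hM : Indec M) :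
    OutInj x M ∨ Conc x M := by
  obtain ⟨q, q1, q2⟩ := exists_proj (LinearMap.ker (outMap (flipO x Λ) M x))
  have hk : ∀ v, v ∈ LinearMap.ker (outMap (flipO x Λ) M x) ↔ ∀ b i, M.f x b i v = 0 := by
    intro v
    rw [LinearMap.mem_ker]
    constructor
    · intro h b i
      exact congrFun h ⟨b, i⟩
    · intro h
      funext p
      exact h p.1 p.2
  obtain ⟨e, e1, e2⟩ := single_hom (x := x) M (by rw [flip_in]; exact hx x) q (by
      intro a i v
      have h1 := i.2
      have h2 := hx a
      have h3 := flip_in x a Λ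
      omega) (by
      intro b i v
      exact (hk _).1 (q1 v) b i)
  rcases hM.2 e (by
    intro z v
    by_cases hz : z = x
    · subst hz
      rw [e1]; simp [q2 _ (q1 v)]
    · rw [e2 z hz]; rfl) with h | h
  · left
    intro u hu
    have h0 := h x u
    rw [e1, q2] at h0
    · exact h0
    · rw [hk]
      intro b i
      rw [← Rep.F_fin, hu]
  · right
    intro z hz
    by_contra hd
    have := h z (fun _ => 1)
    rw [e2 z hz] at this
    exact zero_ne_one (congrFun this ⟨0, Nat.pos_of_ne_zero hd⟩)

theorem loop_zero_of_sink {x : Fin m} (hx : IsSink Λ x) : Λ x x = 0 := hx x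

theorem Conc.f_zero {x : Fin m} (hl : Λ x x = 0) {M : Rep K m Λ} (hc : Conc x M) (a b i v) :
    M.f a b i v = 0 := by
  by_cases hb : b = x
  · by_cases ha : a = x
    · subst ha; subst hb; have := i.2; omega
    · rw [vec_zero (hc a ha) v 0, map_zero]
  · exact vec_zero (hc b hb) _ _

/-- an indecomposable concentrated at `x` is one-dimensional -/
theorem Conc.dim {x : Fin m} (hl : Λ x x = 0) {M : Rep K m Λ} (hM : Indec M) (hc : Conc x M) :
    M.d x = 1 := by
  have hpos : 0 < M.d x := by
    by_contra h
    apply hM.1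
    intro z
    by_cases hz : z = x
    · subst hz; omega
    · exact hc z hz
  let v0 : Fin (M.d x) → K := Pi.single ⟨0, hpos⟩ 1
  obtain ⟨q, q1, q2⟩ := exists_proj (K ∙ v0)
  obtain ⟨e, e1, e2⟩ := single_hom (x := x) M hl q
    (fun a i v => by rw [hc.f_zero hl, map_zero]) (fun b i v => hc.f_zero hl _ _ _ _)
  rcases hM.2 e (by
    intro z v
    by_cases hz : z = x
    · subst hz
      rw [e1]; simp [q2 _ (q1 v)]
    · rw [e2 z hz]; rfl) with h | h
  · exfalso
    have h0 := h x v0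
    rw [e1, q2 _ (Submodule.mem_span_singleton_self v0)] at h0
    have := congrFun h0 ⟨0, hpos⟩
    simp [v0] at this
  · by_contra hne
    have h1 : 1 < M.d x := by omega
    have h0 := h x (Pi.single ⟨1, h1⟩ 1)
    have h2 := q1 (Pi.single ⟨1, h1⟩ 1)
    rw [e1] at h0
    rw [h0, Submodule.mem_span_singleton] at h2
    obtain ⟨c, hc⟩ := h2
    have := congrFun hc ⟨1, h1⟩
    simp [v0, Pi.single_apply] at this

theorem Conc.dv {x : Fin m} (hl : Λ x x = 0) {M : Rep K m Λ} (hM : Indec M) (hc : Conc x M) :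
    dv M = ev x := by
  funext z
  by_cases hz : z = x
  · subst hz; simp [KP.dv, ev, hc.dim hl hM]
  · simp [KP.dv, ev, hz, hc z hz]

theorem conc_of_dv {x : Fin m} {M : Rep K m Λ} (h : dv M = ev x) : Conc x M := by
  intro z hz
  have := congrFun h z
  simpa [dv, ev, hz] using this

theorem hom_of_conc {x : Fin m} (hx : IsSink Λ x) {M N : Rep K m Λ} (hc : Conc x M)
    (l : (Fin (M.d x) → K) →ₗ[K] (Fin (N.d x) → K)) : ∃ f : RepHom M N, f.g x = l := by
  obtain ⟨g, g1, g2⟩ := glue (P := fun z => (Fin (M.d z) → K) →ₗ[K] (Fin (N.d z) → K)) x l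
    (fun z _ => 0)
  refine ⟨⟨g, ?_⟩, g1⟩
  intro a b i v
  by_cases ha : a = x
  · subst ha
    have h1 := i.2
    have h2 := hx b
    omega
  · rw [vec_zero (hc a ha) v 0]; simp

theorem iso_of_dv {x : Fin m} (hx : IsSink Λ x) {M N : Rep K m Λ} (hM : dv M = ev x)
    (hN : dv N = ev x) : RepIso M N := by
  have hd : ∀ z, M.d z = N.d z := by
    intro z
    have := congrFun (hM.trans hN.symm) z
    simpa [dv] using this
  obtain ⟨f, hf⟩ := hom_of_conc hx (N := N) (conc_of_dv hM) (castL K (hd x)).toLinearMap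
  refine repIso_iff.2 ⟨f, fun z => ?_⟩
  by_cases hz : z = x
  · subst hz; rw [hf]; exact (castL K (hd z)).bijective
  · exact ⟨fun a b _ => vec_zero (conc_of_dv hM z hz) _ _,
      fun b => ⟨0, vec_zero (conc_of_dv hN z hz) _ _⟩⟩

theorem simple_dv (x : Fin m) : dv (simpleRep (k := K) Λ x) = ev x := by
  funext z
  by_cases hz : z = x <;> simp [dv, ev, simpleRep, hz]

theorem simple_indec (x : Fin m) : Indec (simpleRep (k := K) Λ x) := by
  have h1 : (simpleRep (k := K) Λ x).d x = 1 := by simp [simpleRep]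
  have hc : Conc x (simpleRep (k := K) Λ x) := conc_of_dv (simple_dv x)
  constructor
  · intro h; have := h x; omega
  · intro e he
    by_cases hz : e.g x = 0
    · left
      intro z v
      by_cases hzx : z = x
      · subst hzx; rw [hz]; rfl
      · exact vec_zero (hc z hzx) _ _
    · right
      have hinj : Function.Injective (e.g x) := by
        have hr : 0 < Module.finrank K (LinearMap.range (e.g x)) := by
          rw [Nat.pos_iff_ne_zero, Ne, Submodule.finrank_eq_zero, LinearMap.range_eq_bot]
          exact hz
        have h2 := LinearMap.finrank_range_add_finrank_ker (e.g x)
        rw [Module.finrank_fin_fun] at h2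
        rw [← LinearMap.ker_eq_bot, ← Submodule.finrank_eq_zero (R := K)]
        omega
      intro z v
      by_cases hzx : z = x
      · subst hzx; exact hinj (he z v)
      · exact vec_zero (hc z hzx) _ _

end Exist

section Final
variable {K : Type} [Field K] {m : ℕ}

theorem dv_nonneg {Λ : Fin m → Fin m → ℕ} (M : Rep K m Λ) : 0 ≤ dv M :=
  fun _ => Int.natCast_nonneg _

theorem reflPlus_zero {Λ : Fin m → Fin m → ℕ} {x : Fin m} (hx : IsSink Λ x) (M : Rep K m Λ)
    (hc : Conc x M) : IsZeroRep (reflPlus x Λ M) := by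
  rw [zero_of]
  intro z v
  by_cases hz : z = x
  · subst hz
    apply (reflPlusRefl z hx M).Jinj
    funext p
    exact vec_zero (hc p.1 (arin_ne hx p)) _ _
  · apply ((reflPlusRefl x hx M).e z hz).symm.injective
    exact vec_zero (hc z hz) _ _

theorem FList_zero : ∀ (S : List (Fin m)) (Λ : Fin m → Fin m → ℕ), Admissible Λ S →
    ∀ M : Rep K m Λ, IsZeroRep M → IsZeroRep (FList S Λ M) := by
  intro S
  induction S with
  | nil => intro Λ _ M h; exact h
  | cons x S ih =>
    intro Λ hS M h
    exact ih _ hS.2 _ (reflPlus_zero hS.1 M (fun z _ => h z))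

theorem ann_conc {Λ : Fin m → Fin m → ℕ} {x : Fin m} (hx : IsSink Λ x) {M : Rep K m Λ}
    (hM : Indec M) (hc : Conc x M) (S : List (Fin m)) : AnnV (edges Λ) (x :: S) (dv M) := by
  right
  rw [hc.dv (hx x) hM]
  exact AnnV.of_neg S (sg_ev_neg (sink_loop hx))

theorem ann_good {Λ : Fin m → Fin m → ℕ} {x : Fin m} (hx : IsSink Λ x) {M : Rep K m Λ}
    {M' : Rep K m (flipO x Λ)} (R : Refl x M M') (hM : Good x M) (S : List (Fin m)) :
    AnnV (edges Λ) (x :: S) (dv M) ↔ AnnV (edges (flipO x Λ)) S (dv M') := by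
  rw [edges_flip, R.dv_eq hx hM]
  constructor
  · rintro (h | h)
    · exact absurd (dv_nonneg M) h
    · exact h
  · exact Or.inr

theorem bridge : ∀ (S : List (Fin m)) (Λ : Fin m → Fin m → ℕ), Admissible Λ S →
    ∀ M : Rep K m Λ, Indec M → (Annihilates Λ S M ↔ AnnV (edges Λ) S (dv M)) := by
  intro S
  induction S with
  | nil =>
    intro Λ _ M hM
    exact ⟨fun h => absurd h hM.1, fun h => absurd (dv_nonneg M) h⟩
  | cons x S ih =>
    intro Λ hS M hM
    rcases indec_good_or_conc hS.1 hM with hg | hc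
    · have R := reflPlusRefl x hS.1 M
      rw [ann_good hS.1 R hg]
      exact ih _ hS.2 _ ((R.indec_iff' hS.1 hg).2 hM)
    · refine ⟨fun _ => ann_conc hS.1 hM hc S, fun _ => ?_⟩
      exact FList_zero S _ hS.2 _ (reflPlus_zero hS.1 M hc)

theorem dimClass : DimClass (fun (Λ : Fin m → Fin m → ℕ) d => ∃ M : Rep K m Λ, Indec M ∧ dv M = d) where
  nonneg := by
    rintro Λ _ ⟨M, _, rfl⟩
    exact dv_nonneg M
  step := by
    rintro Λ _ x ⟨M, hM, rfl⟩ hx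
    rcases indec_good_or_conc hx hM with hg | hc
    · right
      have R := reflPlusRefl x hx M
      exact ⟨_, (R.indec_iff' hx hg).2 hM, R.dv_eq hx hg⟩
    · left
      exact hc.dv (hx x) hM

def Least (Λ : Fin m → Fin m → ℕ) (S : List (Fin m)) (M : Rep K m Λ) : Prop :=
  Admissible Λ S ∧ AnnV (edges Λ) S (dv M) ∧
    ∀ T, Admissible Λ T → AnnV (edges Λ) T (dv M) → ∀ z, S.count z ≤ T.count z

theorem least_of_shortest {Λ : Fin m → Fin m → ℕ} {S : List (Fin m)} {M : Rep K m Λ} (hM : Indec M)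
    (h : IsShortestAnn Λ M S) : Least Λ S M := by
  obtain ⟨h1, h2, h3⟩ := h
  have h2' := (bridge S Λ h1 M hM).1 h2
  refine ⟨h1, h2', fun T hT hA z => ?_⟩
  obtain ⟨R, r1, r2, r3⟩ := meet_exists dimClass S T Λ (dv M) ⟨M, hM, rfl⟩ h1 hT h2' hA
  have := h3 R r1 ((bridge R Λ r1 M hM).2 r2) (preceq_of_count R S Λ r1 h1 fun z => (r3 z).1)
  rw [← this.perm.count_eq]
  exact (r3 z).2

theorem Least.sim {Λ : Fin m → Fin m → ℕ} {S S' : List (Fin m)} {M : Rep K m Λ}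
    (h : Least Λ S M) (hs : Sim (edges Λ) S S') (ha : Admissible Λ S') : Least Λ S' M := by
  refine ⟨ha, AnnV.sim (edges_symm Λ) hs _ h.2.1, fun T hT hA z => ?_⟩
  rw [← hs.perm.count_eq]
  exact h.2.2 T hT hA z

theorem Least.step {Λ : Fin m → Fin m → ℕ} {x : Fin m} {T : List (Fin m)} {N : Rep K m Λ}
    {N' : Rep K m (flipO x Λ)} (R : Refl x N N') (hg : Good x N) (h : Least Λ (x :: T) N) :
    Least (flipO x Λ) T N' := by
  have hx := h.1.1
  refine ⟨h.1.2, (ann_good hx R hg T).1 h.2.1, fun U hU hA z => ?_⟩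
  have := h.2.2 (x :: U) ⟨hx, hU⟩ ((ann_good hx R hg U).2 hA) z
  rw [List.count_cons, List.count_cons] at this
  omega

theorem conc_least {Λ : Fin m → Fin m → ℕ} {x : Fin m} (hx : IsSink Λ x) {M : Rep K m Λ}
    (hM : Indec M) (hc : Conc x M) : Least Λ [x] M := by
  refine ⟨⟨hx, trivial⟩, ann_conc hx hM hc [], fun T hT hA z => ?_⟩
  have hxT : x ∈ T := by
    by_contra hn
    have := dim_zero_of_not_mem dimClass T Λ (dv M) ⟨M, hM, rfl⟩ hT hA x hn
    rw [hc.dv (hx x) hM] at this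
    simp [ev] at this
  by_cases hz : z = x
  · subst hz
    have := List.count_pos_iff.2 hxT
    simp only [List.count_singleton_self]
    omega
  · have : List.count z [x] = 0 := List.count_eq_zero.2 (by simpa using hz)
    omega

/-! ### paths -/

def Step {Λ : Fin m → Fin m → ℕ} (A B : Rep K m Λ) : Prop := Indec A ∧ Indec B ∧ RepStep A B

def PathR {Λ : Fin m → Fin m → ℕ} (A B : Rep K m Λ) : Prop :=
  RepIso A B ∨ Relation.TransGen Step A B

theorem Step.iso_left {Λ : Fin m → Fin m → ℕ} {A A' B : Rep K m Λ} (hA : Indec A')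
    (h : RepIso A' A) (s : Step A B) : Step A' B := by
  obtain ⟨_, hB, f, ⟨x, v, hv⟩, hb⟩ := s
  obtain ⟨i, hi⟩ := repIso_iff.1 h
  refine ⟨hA, hB, f.comp' i, ?_, ?_⟩
  · obtain ⟨u, rfl⟩ := (hi x).2 v
    exact ⟨x, u, hv⟩
  · intro h'
    apply hb
    intro z
    exact (Function.Bijective.of_comp_iff (f.g z) (hi z)).1 (h' z)

theorem Step.iso_right {Λ : Fin m → Fin m → ℕ} {A B B' : Rep K m Λ} (hB' : Indec B')
    (h : RepIso B B') (s : Step A B) : Step A B' := by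
  obtain ⟨hA, hB, f, ⟨x, v, hv⟩, hb⟩ := s
  obtain ⟨i, hi⟩ := repIso_iff.1 h
  refine ⟨hA, hB', i.comp' f, ⟨x, v, ?_⟩, ?_⟩
  · intro h0
    exact hv ((hi x).1 (h0.trans (map_zero (i.g x)).symm))
  · intro h'
    apply hb
    intro z
    exact (Function.Bijective.of_comp_iff' (hi z) (f.g z)).1 (h' z)

theorem PathR.iso_left {Λ : Fin m → Fin m → ℕ} {A A' B : Rep K m Λ} (hA : Indec A')
    (h : RepIso A' A) (s : PathR A B) : PathR A' B := by
  rcases s with s | s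
  · exact Or.inl (h.trans' s)
  · obtain ⟨C, h1, h2⟩ := Relation.TransGen.head'_iff.1 s
    exact Or.inr (Relation.TransGen.head'_iff.2 ⟨C, h1.iso_left hA h, h2⟩)

theorem PathR.cons {Λ : Fin m → Fin m → ℕ} {A B N : Rep K m Λ} (hN : Indec N) (h : Step A B)
    (s : PathR B N) : PathR A N := by
  rcases s with s | s
  · exact Or.inr (Relation.TransGen.single (h.iso_right hN s))
  · exact Or.inr (Relation.TransGen.head h s)

theorem out_of_hom {Λ : Fin m → Fin m → ℕ} {x : Fin m} (hx : IsSink Λ x)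
    {A B : Rep K m (flipO x Λ)} (hA : Indec A) (f : RepHom A B) (hf : f.NZ) (hB : OutInj x B) :
    OutInj x A := by
  rcases indec_out_or_conc hx hA with h | hc
  · exact h
  · exfalso
    obtain ⟨z, v, hv⟩ := hf
    have hl : flipO x Λ x x = 0 := by rw [flip_in]; exact hx x
    by_cases hz : z = x
    · subst hz
      apply hv
      apply hB
      intro b i
      rw [← f.commF]
      have : A.F z b i v = 0 := by
        unfold Rep.F
        split
        · exact hc.f_zero hl _ _ _ _
        · rfl
      rw [this, map_zero]
    · apply hv
      rw [vec_zero (hc z hz) v 0, map_zero]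

theorem step_down {Λ : Fin m → Fin m → ℕ} {x : Fin m} (hx : IsSink Λ x) {A B : Rep K m Λ}
    {A' B' : Rep K m (flipO x Λ)} (R : Refl x A A') (R2 : Refl x B B') (hA : Good x A)
    (hB : Good x B) (s : Step A' B') : Step A B := by
  obtain ⟨h1, h2, f, f1, f2⟩ := s
  obtain ⟨g, r⟩ := relB hx R R2 hA f
  exact ⟨(R.indec_iff' hx hA).1 h1, (R2.indec_iff' hx hB).1 h2, g, r.nz_down hx f1,
    fun hb => f2 (r.bij_up hx hb)⟩

theorem lift_trans {Λ : Fin m → Fin m → ℕ} {x : Fin m} (hx : IsSink Λ x) {N : Rep K m Λ}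
    {N' : Rep K m (flipO x Λ)} (RN : Refl x N N') (hN : Good x N) {X' : Rep K m (flipO x Λ)}
    (h : Relation.TransGen Step X' N') :
    OutInj x X' ∧ ∀ X : Rep K m Λ, Refl x X X' → Good x X → Relation.TransGen Step X N := by
  induction h using Relation.TransGen.head_induction_on with
  | single s =>
    obtain ⟨h1, h2, f, f1, f2⟩ := id s
    refine ⟨out_of_hom hx h1 f f1 (RN.outInj hx), fun X R hX => ?_⟩
    exact Relation.TransGen.single (step_down hx R RN hX hN s)
  | head s _ ih =>
    obtain ⟨h1, h2, f, f1, f2⟩ := id s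
    refine ⟨out_of_hom hx h1 f f1 ih.1, fun X R hX => ?_⟩
    obtain ⟨R2⟩ := reflMinusRefl hx _ ih.1
    exact Relation.TransGen.head (step_down hx R R2 hX (reflMinus_good hx _) s)
      (ih.2 _ R2 (reflMinus_good hx _))

theorem lift_path {Λ : Fin m → Fin m → ℕ} {x : Fin m} (hx : IsSink Λ x) {N X : Rep K m Λ}
    {N' X' : Rep K m (flipO x Λ)} (RN : Refl x N N') (hN : Good x N) (R : Refl x X X')
    (hX : Good x X) (h : PathR X' N') : PathR X N := by
  rcases h with h | h
  · exact Or.inl (R.iso_down hx RN hX hN h)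
  · exact Or.inr ((lift_trans hx RN hN h).2 X R hX)

theorem ann_of_hom : ∀ (S : List (Fin m)) (Λ : Fin m → Fin m → ℕ), Admissible Λ S →
    ∀ (A B : Rep K m Λ), Indec A → Indec B → ∀ f : RepHom A B, f.NZ →
    AnnV (edges Λ) S (dv B) → AnnV (edges Λ) S (dv A) := by
  intro S
  induction S with
  | nil => intro Λ _ A B _ _ f _ h; exact absurd (dv_nonneg B) h
  | cons x S ih =>
    intro Λ hS A B hA hB f hf h
    rcases indec_good_or_conc hS.1 hA with gA | cA
    · rcases indec_good_or_conc hS.1 hB with gB | cB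
      · have RA := reflPlusRefl x hS.1 A
        have RB := reflPlusRefl x hS.1 B
        obtain ⟨f', r⟩ := relA hS.1 RA RB f
        rw [ann_good hS.1 RA gA]
        rw [ann_good hS.1 RB gB] at h
        exact ih _ hS.2 _ _ ((RA.indec_iff' hS.1 gA).2 hA) ((RB.indec_iff' hS.1 gB).2 hB) f'
          (r.nz_up hS.1 gA hf) h
      · exfalso
        obtain ⟨z, v, hv⟩ := hf
        apply hv
        exact uniq_good hS.1 gA (h1 := f) (h2 := zeroHom A B)
          (fun z hz v => vec_zero (cB z hz) _ _) z v
    · exact ann_conc hS.1 hA cA S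

theorem ann_of_path {Λ : Fin m → Fin m → ℕ} {S : List (Fin m)} (hS : Admissible Λ S)
    {M N : Rep K m Λ} (h : PathR M N) (hA : AnnV (edges Λ) S (dv N)) :
    AnnV (edges Λ) S (dv M) := by
  rcases h with h | h
  · have : dv M = dv N := by
      funext z
      simp only [dv, h.dim z]
    rw [this]
    exact hA
  · induction h using Relation.TransGen.head_induction_on with
    | single s =>
      obtain ⟨h1, h2, f, f1, f2⟩ := s
      exact ann_of_hom S Λ hS _ _ h1 h2 f f1 hA
    | head s _ ih =>
      obtain ⟨h1, h2, f, f1, f2⟩ := s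
      exact ann_of_hom S Λ hS _ _ h1 h2 f f1 ih

theorem refl_off {Λ : Fin m → Fin m → ℕ} {x : Fin m} (hx : IsSink Λ x) {X : Rep K m Λ}
    {X' : Rep K m (flipO x Λ)} (R : Refl x X X') (hX : Good x X) {z : Fin m} (hz : z ≠ x) :
    dv X' z = dv X z := by
  rw [R.dv_eq hx hX]
  simp [sg, hz]

theorem main_ind : ∀ (l : ℕ) (Λ : Fin m → Fin m → ℕ), (∀ x, ∃ y, edges Λ x y ≠ 0) →
    ∀ (S T : List (Fin m)) (M N : Rep K m Λ), T.length ≤ l → Indec M → Indec N →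
    Least Λ S M → Least Λ T N → (∀ z, S.count z ≤ T.count z) → PathR M N := by
  intro l
  induction l with
  | zero =>
    intro Λ _ S T M N hl _ _ _ hT _
    have : T = [] := List.length_eq_zero_iff.1 (by omega)
    subst this
    exact absurd (dv_nonneg N) hT.2.1
  | succ l ih =>
    intro Λ hE S T0 M N hl hM hN hS hT0 hc0
    cases S with
    | nil => exact absurd (dv_nonneg M) hS.2.1
    | cons x S =>
    have hx : IsSink Λ x := hS.1.1
    have hxT : x ∈ T0 := by
      have := hc0 x
      rw [List.count_cons_self] at this
      exact List.count_pos_iff.1 (by omega)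
    obtain ⟨T, hsim, hadm⟩ := extract T0 Λ x hx hT0.1 hxT
    have hT : Least Λ (x :: T) N := hT0.sim hsim hadm
    have hl' : T.length ≤ l := by
      have := hsim.perm.length_eq
      simp only [List.length_cons] at this
      omega
    have hc : ∀ z, (x :: S).count z ≤ (x :: T).count z := by
      intro z
      rw [← hsim.perm.count_eq]
      exact hc0 z
    have hE' : ∀ v u : Fin m, ∃ y, edges (flipO v Λ) u y ≠ 0 := by
      intro v u
      rw [edges_flip]
      exact hE u
    by_cases cM : Conc x M
    · have dM := cM.dv (hx x) hM
      by_cases cN : Conc x N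
      · exact Or.inl (iso_of_dv hx dM (cN.dv (hx x) hN))
      have gN : Good x N := (indec_good_or_conc hx hN).resolve_right cN
      have RN := reflPlusRefl x hx N
      have hN' := (RN.indec_iff' hx gN).2 hN
      have hT' := hT.step RN gN
      cases T with
      | nil => exact absurd (dv_nonneg _) hT'.2.1
      | cons w T =>
      have hw' : IsSink (flipO x Λ) w := hT'.1.1
      have hwx : w ≠ x := by
        rintro rfl
        obtain ⟨y, hy⟩ := hE w
        apply hy
        have h1 := hw' y
        rw [flip_out] at h1
        simp [edges, h1, hx y]
      simp only [List.length_cons] at hl'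
      by_cases hxw : edges Λ x w = 0
      · -- `w` is already a sink
        have hw : IsSink Λ w := (sink_flip hxw hwx.symm).1 hw'
        have hwx0 : edges Λ w x = 0 := by rw [edges_symm]; exact hxw
        have cN : ¬ Conc w N := by
          intro c
          have h1 := hT.2.2 [w] ⟨hw, trivial⟩ (conc_least hw hN c).2.1 x
          have h2 : List.count x [w] = 0 := List.count_eq_zero.2 (by simpa using hwx.symm)
          rw [List.count_cons_self] at h1
          omega
        have gN : Good w N := (indec_good_or_conc hw hN).resolve_right cN
        have RN := reflPlusRefl w hw N
        have hN' := (RN.indec_iff' hw gN).2 hN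
        have hx' : IsSink (flipO w Λ) x := (sink_flip hwx0 hwx).2 hx
        have hadm2 : Admissible Λ (w :: x :: T) := by
          refine ⟨hw, hx', ?_⟩
          rw [flip_comm]
          exact hT'.1.2
        have hT2 : Least Λ (w :: x :: T) N :=
          hT.sim (Relation.ReflTransGen.single (SwapRel.swap [] T x w hxw)) hadm2
        have hT3 := hT2.step RN gN
        have dL := simple_dv (K := K) (Λ := flipO w Λ) x
        have hL := simple_indec (K := K) (Λ := flipO w Λ) x
        have key := ih (flipO w Λ) (hE' w) [x] (x :: T) _ _ (by simp only [List.length_cons]; omega)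
          hL hN' (conc_least hx' hL (conc_of_dv dL)) hT3 (by
            intro z; rw [List.count_cons, List.count_cons]; simp)
        have hO : OutInj w (simpleRep (k := K) (flipO w Λ) x) := by
          intro u _
          exact vec_zero (conc_of_dv dL w hwx) _ _
        obtain ⟨R⟩ := reflMinusRefl hw _ hO
        have gX := reflMinus_good hw (simpleRep (k := K) (flipO w Λ) x)
        have hXN := lift_path hw RN gN R gX key
        refine hXN.iso_left hM (iso_of_dv hx dM ?_)
        have hoff : ∀ z, z ≠ w → dv (reflMinus w Λ (simpleRep (k := K) (flipO w Λ) x)) z = ev x z := by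
          intro z hz
          rw [← refl_off hw R gX hz, dL]
        funext z
        by_cases hz : z = w
        · subst hz
          have h1 := congrFun (R.dv_eq hw gX) z
          rw [dL] at h1
          simp only [sg, if_true] at h1
          rw [Finset.sum_eq_zero] at h1
          · have h2 : ev x z = 0 := by simp [ev, hwx]
            rw [h2] at h1 ⊢
            omega
          · intro y _
            by_cases hy : y = z
            · subst hy
              rw [sink_loop hw]
              simp
            · rw [hoff y hy]
              by_cases hyx : y = x
              · subst hyx; rw [hwx0]; simp
              · simp [ev, hyx]
        · exact hoff z hz
      · -- `w` is a neighbour of `x`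
        have dL := simple_dv (K := K) (Λ := flipO x Λ) w
        have hL := simple_indec (K := K) (Λ := flipO x Λ) w
        have key := ih (flipO x Λ) (hE' x) [w] (w :: T) _ _ (by simp only [List.length_cons]; omega)
          hL hN' (conc_least hw' hL (conc_of_dv dL)) hT' (by
            intro z; rw [List.count_cons, List.count_cons]; simp)
        have hO : OutInj x (simpleRep (k := K) (flipO x Λ) w) := by
          intro u _
          exact vec_zero (conc_of_dv dL x hwx.symm) _ _
        obtain ⟨R⟩ := reflMinusRefl hx _ hO
        have gX := reflMinus_good hx (simpleRep (k := K) (flipO x Λ) w)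
        have hX := (R.indec_iff' hx gX).1 hL
        have hXN := lift_path hx RN gN R gX key
        generalize reflMinus x Λ (simpleRep (k := K) (flipO x Λ) w) = X at *
        refine PathR.cons hN ?_ hXN
        have hXw : dv X w = 1 := by
          rw [← refl_off hx R gX hwx, dL]
          simp [ev]
        have hXx : 0 < X.d x := by
          by_contra h0
          have h0' : dv X x = 0 := by simp only [dv]; omega
          have h1 := congrFun (R.dv_eq hx gX) x
          rw [dL] at h1
          simp only [sg, if_true, h0'] at h1
          have h2 : ev w x = 0 := by simp [ev, hwx.symm]
          rw [h2] at h1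
          have h3 : (edges Λ x w : ℤ) * dv X w ≤ ∑ y, (edges Λ x y : ℤ) * dv X y :=
            Finset.single_le_sum (f := fun y => (edges Λ x y : ℤ) * dv X y)
              (fun y _ => mul_nonneg (Int.natCast_nonneg _) (dv_nonneg X y)) (Finset.mem_univ w)
          rw [hXw] at h3
          omega
        have hMx : M.d x = 1 := cM.dim (hx x) hM
        let u : Fin (X.d x) → K := fun _ => 1
        obtain ⟨f, hf⟩ := hom_of_conc hx cM (N := X)
          (LinearMap.toSpanSingleton K _ u ∘ₗ LinearMap.proj (⟨0, by omega⟩ : Fin (M.d x)))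
        refine ⟨hM, hX, f, ⟨x, fun _ => 1, ?_⟩, ?_⟩
        · rw [hf]
          intro h0
          have := congrFun h0 ⟨0, hXx⟩
          simp [u] at this
        · intro hb
          have h1 := (repIso_iff.2 ⟨f, hb⟩).dim w
          have h2 := cM w hwx
          simp only [dv] at hXw
          omega
    · have gM : Good x M := (indec_good_or_conc hx hM).resolve_right cM
      have RM := reflPlusRefl x hx M
      have hM' := (RM.indec_iff' hx gM).2 hM
      have hS' := hS.step RM gM
      have cN : ¬ Conc x N := by
        intro c
        cases S with
        | nil => exact absurd (dv_nonneg _) hS'.2.1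
        | cons w S =>
          have h1 := hT.2.2 [x] ⟨hx, trivial⟩ (conc_least hx hN c).2.1 w
          have h2 := hc w
          rw [List.count_cons, List.count_cons_self] at h2
          rw [List.count_singleton] at h1
          omega
      have gN : Good x N := (indec_good_or_conc hx hN).resolve_right cN
      have RN := reflPlusRefl x hx N
      have hN' := (RN.indec_iff' hx gN).2 hN
      have hT' := hT.step RN gN
      have key := ih (flipO x Λ) (hE' x) S T _ _ hl' hM' hN' hS' hT' (by
        intro z
        have := hc z
        rw [List.count_cons, List.count_cons] at this
        omega)
      exact lift_path hx RN gN RM gM key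

theorem path_mono {Λ : Fin m → Fin m → ℕ} {M N : Rep K m Λ} :
    (RepIso M N ∨ Relation.TransGen
        (fun A B : Rep K m Λ => Indecomp A ∧ Indecomp B ∧ RepStep A B) M N) ↔ PathR M N := by
  have : (fun A B : Rep K m Λ => Indecomp A ∧ Indecomp B ∧ RepStep A B) = Step := by
    funext A B
    simp only [indec_iff, Step]
  rw [this]
  rfl

end Final

theorem path_order_iff_preceq
    (n : ℕ) (hn : 2 ≤ n) (Λ : Fin n → Fin n → ℕ)
    (hloop : ∀ a, Λ a a = 0)
    (hconn : ∀ a b : Fin n, Relation.ReflTransGen (fun u v => edges Λ u v ≠ 0) a b)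
    (hacyc : ∀ a : Fin n, ¬ Relation.TransGen (fun u v => Λ u v ≠ 0) a a)
    (k : Type) [Field k]
    (M N : Rep k n Λ) (hMi : Indecomp M) (hNi : Indecomp N)
    (hMp : Preprojective Λ M) (hNp : Preprojective Λ N)
    (SM SN : List (Fin n)) (hSM : IsShortestAnn Λ M SM) (hSN : IsShortestAnn Λ N SN) :
    (RepIso M N ∨ Relation.TransGen
        (fun A B : Rep k n Λ => Indecomp A ∧ Indecomp B ∧ RepStep A B) M N)
      ↔ Preceq Λ SM SN := by
  rw [path_mono]
  have hM := indec_iff.1 hMi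
  have hN := indec_iff.1 hNi
  have hM2 := least_of_shortest hM hSM
  have hN2 := least_of_shortest hN hSN
  constructor
  · intro h
    exact preceq_of_count SM SN Λ hM2.1 hN2.1
      (hM2.2.2 SN hN2.1 (ann_of_path hN2.1 h hN2.2.1))
  · intro h
    refine main_ind SN.length Λ ?_ SM SN M N le_rfl hM hN hM2 hN2 (count_of_preceq h)
    intro x
    obtain ⟨y, hy⟩ : ∃ y : Fin n, y ≠ x := by
      have : Nontrivial (Fin n) := Fin.nontrivial_iff_two_le.2 hn
      exact exists_ne x
    rcases (hconn x y).cases_head with h1 | ⟨z, h1, _⟩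
    · exact absurd h1.symm hy
    · exact ⟨z, h1⟩

end KP
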